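/- arXiv:1205.0600 — 15 statements merged into one kernel-verified Lean document; each statement's English description precedes it below -/
import Mathlib

section
/- Let X be a non-empty compact Hausdorff topological space and let φ be a continuous weak selection on X. Then there exists a φ-king, i.e., an element z ∈ X such that for every x ∈ X there exists y ∈ X with z →_φ y →_φ x. -/
/-- A weak selection on `X`, encoded as a symmetric function `φ : X → X → X`
with `φ a b ∈ {a, b}` for all `a b`. -/
def IsWeakSelection {X : Type*} (φ : X → X → X) : Prop :=
  (∀ a b : X, φ a b = φ b a) ∧ (∀ a b : X, φ a b = a ∨ φ a b = b)

/-- `a →_φ b` : either `a = b`, or `a ≠ b` and `φ {a,b} = b`. -/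
def SelArrow {X : Type*} (φ : X → X → X) (a b : X) : Prop :=
  a = b ∨ (a ≠ b ∧ φ a b = b)

/-- `z` is a `φ`-king: for every `x` there is `y` with `z →_φ y →_φ x`. -/
def IsKing {X : Type*} (φ : X → X → X) (z : X) : Prop :=
  ∀ x : X, ∃ y : X, SelArrow φ z y ∧ SelArrow φ y x

/-- Continuity of a weak selection `φ` on a topological space `X`. -/
def ContWeakSel {X : Type*} [TopologicalSpace X] (φ : X → X → X) : Prop :=
  ∀ a b : X, a ≠ b → ∀ W : Set X, IsOpen W → φ a b ∈ W →
    ∃ U V : Set X, IsOpen U ∧ IsOpen V ∧ a ∈ U ∧ b ∈ V ∧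
      ∀ a' ∈ U, ∀ b' ∈ V, a' ≠ b' → φ a' b' ∈ W

/-- A king space: every continuous weak selection has a king. -/
def IsKingSpace (X : Type*) [TopologicalSpace X] : Prop :=
  ∀ φ : X → X → X, IsWeakSelection φ → ContWeakSel φ → ∃ z : X, IsKing φ z

theorem exists_king_of_finset {α : Type*} {r : α → α → Prop} (hr : ∀ a b, r a b ∨ r b a)
    (s : Finset α) (hs : s.Nonempty) : ∃ z, ∀ x ∈ s, ∃ y, r z y ∧ r y x := by
  classical
  suffices h : ∃ z ∈ s, ∀ x ∈ s, ∃ y ∈ s, r z y ∧ r y x by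
    obtain ⟨z, -, hz⟩ := h
    exact ⟨z, fun x hx => (hz x hx).imp fun _ => And.right⟩
  have refl : ∀ a, r a a := fun a => (hr a a).elim id id
  induction hs using Finset.Nonempty.cons_induction with
  | singleton a => simp [refl]
  | cons a s ha hs ih =>
    obtain ⟨z, hzs, hz⟩ := ih
    by_cases h : ∃ y ∈ s, r z y ∧ r y a
    · refine ⟨z, by simp [hzs], fun x hx => ?_⟩
      rcases Finset.mem_cons.1 hx with rfl | hx
      · obtain ⟨y, hy, h⟩ := h
        exact ⟨y, by simp [hy], h⟩
      · obtain ⟨y, hy, h⟩ := hz x hx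
        exact ⟨y, by simp [hy], h⟩
    · refine ⟨a, by simp, fun x hx => ?_⟩
      rcases Finset.mem_cons.1 hx with rfl | hx
      · exact ⟨x, by simp, refl x, refl x⟩
      · obtain ⟨y, hy, hzy, hyx⟩ := hz x hx
        exact ⟨y, by simp [hy], (hr a y).resolve_right fun hya => h ⟨y, hy, hzy, hya⟩, hyx⟩

/-- A closed total relation on a non-empty compact space has a king. -/
theorem exists_king_of_isClosed {X : Type*} [TopologicalSpace X] [CompactSpace X] [Nonempty X]
    {r : X → X → Prop} (hr : ∀ a b, r a b ∨ r b a) (hc : IsClosed {p : X × X | r p.1 p.2}) :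
    ∃ z, ∀ x, ∃ y, r z y ∧ r y x := by
  have hclosed : ∀ x, IsClosed {z | ∃ y, r z y ∧ r y x} := fun x => by
    have hx : IsClosed {p : X × X | r p.1 p.2 ∧ r p.2 x} :=
      hc.inter (hc.preimage (f := fun p : X × X => (p.2, x)) (by fun_prop))
    convert isClosedMap_fst_of_compactSpace _ hx using 1
    ext z
    simp
  obtain ⟨z, hz⟩ := CompactSpace.iInter_nonempty hclosed fun s => by
    rcases s.eq_empty_or_nonempty with rfl | hs
    · simp
    · obtain ⟨z, hz⟩ := exists_king_of_finset hr s hs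
      exact ⟨z, Set.mem_iInter₂.2 hz⟩
  exact ⟨z, Set.mem_iInter.1 hz⟩

theorem IsWeakSelection.selArrow_total {X : Type*} {φ : X → X → X} (hφ : IsWeakSelection φ)
    (a b : X) : SelArrow φ a b ∨ SelArrow φ b a := by
  have := hφ.1 a b
  have := hφ.2 a b
  unfold SelArrow
  grind

theorem ContWeakSel.isClosed_selArrow {X : Type*} [TopologicalSpace X] [T2Space X]
    {φ : X → X → X} (hφ : IsWeakSelection φ) (hc : ContWeakSel φ) :
    IsClosed {p : X × X | SelArrow φ p.1 p.2} := by
  rw [← isOpen_compl_iff, isOpen_iff_mem_nhds]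
  rintro ⟨a, b⟩ hab
  simp only [SelArrow, Set.mem_compl_iff, Set.mem_ofPred_eq, not_or, not_and] at hab
  obtain ⟨hne, h⟩ := hab
  have hφa : φ a b = a := (hφ.2 a b).resolve_right (h hne)
  obtain ⟨A, B, hA, hB, haA, hbB, hAB⟩ := t2_separation hne
  obtain ⟨U, V, hU, hV, haU, hbV, hUV⟩ := hc a b hne A hA (hφa.symm ▸ haA)
  filter_upwards [prod_mem_nhds ((hA.inter hU).mem_nhds ⟨haA, haU⟩)
    ((hB.inter hV).mem_nhds ⟨hbB, hbV⟩)]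
  rintro ⟨x, y⟩ ⟨⟨hxA, hxU⟩, hyB, hyV⟩ (hxy | ⟨hxy, hφy⟩)
  · exact hAB.ne_of_mem hxA hyB hxy
  · exact hAB.ne_of_mem (hUV x hxU y hyV hxy) hyB hφy

/-- Every continuous weak selection on a non-empty compact Hausdorff space has
a king. -/
theorem compact_king {X : Type*} [TopologicalSpace X] [CompactSpace X]
    [T2Space X] [Nonempty X]
    (φ : X → X → X) (hφ : IsWeakSelection φ) (hc : ContWeakSel φ) :
    ∃ z : X, IsKing φ z :=
  exists_king_of_isClosed hφ.selArrow_total (hc.isClosed_selArrow hφ)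
end

section
/- Let X be a Hausdorff topological space and let φ be a continuous weak selection on X. Then the set F = {(a,b) ∈ X × X : a →_φ b} is a closed subset of X × X. -/
/-- For a continuous weak selection on a Hausdorff space, the relation
`{(a,b) : a →_φ b}` is closed in `X × X`. -/
theorem arrow_relation_closed {X : Type*} [TopologicalSpace X] [T2Space X]
    (φ : X → X → X) (hφ : IsWeakSelection φ) (hc : ContWeakSel φ) :
    IsClosed {p : X × X | SelArrow φ p.1 p.2} := by
  rw [← isOpen_compl_iff, isOpen_iff_forall_mem_open]
  rintro ⟨a, b⟩ hab
  simp only [Set.mem_compl_iff, Set.mem_ofPred_eq, SelArrow, not_or, not_and] at hab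
  obtain ⟨hne, hb⟩ := hab
  have ha : φ a b = a := (hφ.2 a b).resolve_right (hb hne)
  obtain ⟨P, Q, hP, hQ, haP, hbQ, hPQ⟩ := t2_separation hne
  obtain ⟨U, V, hU, hV, haU, hbV, hUV⟩ := hc a b hne P hP (by rwa [ha])
  refine ⟨(U ∩ P) ×ˢ (V ∩ Q), ?_, (hU.inter hP).prod (hV.inter hQ), ⟨haU, haP⟩, hbV, hbQ⟩
  rintro ⟨x, y⟩ ⟨⟨hxU, hxP⟩, hyV, hyQ⟩ hxy
  have hne' : x ≠ y := hPQ.ne_of_mem hxP hyQ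
  rcases hxy with h | ⟨-, h⟩
  · exact hne' h
  · exact hPQ.ne_of_mem (hUV x hxU y hyV hne') hyQ h
end

section
/- Let X be a compact Hausdorff topological space and let φ be a continuous weak selection on X. Then for every x ∈ X the set K_{φ,x} = {z ∈ X : there exists y ∈ X with z →_φ y →_φ x} is closed in X. -/
/-- For a continuous weak selection on a compact Hausdorff space, each set
`K_{φ,x} = {z : ∃ y, z →_φ y →_φ x}` is closed in `X`. -/
theorem K_closed {X : Type*} [TopologicalSpace X] [CompactSpace X] [T2Space X]
    (φ : X → X → X) (hφ : IsWeakSelection φ) (hc : ContWeakSel φ) (x : X) :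
    IsClosed {z : X | ∃ y : X, SelArrow φ z y ∧ SelArrow φ y x} := by
  have hR := hc.isClosed_selArrow hφ
  have hx : IsClosed {p : X × X | SelArrow φ p.2 x} :=
    hR.preimage (f := fun p : X × X => (p.2, x)) (by fun_prop)
  convert ((hR.inter hx).isCompact.image continuous_fst).isClosed using 1
  ext z
  simp
end

section
/- Let X be a set and let φ be a weak selection on X. Then the family {K_{φ,x} : x ∈ X} has the finite intersection property; that is, for every non-empty finite subset S of X, the intersection ⋂_{x ∈ S} K_{φ,x} is non-empty. -/
/-- Every non-empty finite subset has a king: a king among the elements strictly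
dominating a given `x` is a king of the whole subset. -/
theorem IsWeakSelection.exists_king_finset {X : Type*} {φ : X → X → X}
    (hφ : IsWeakSelection φ) (S : Finset X) (hS : S.Nonempty) :
    ∃ z ∈ S, ∀ x ∈ S, ∃ y ∈ S, SelArrow φ z y ∧ SelArrow φ y x := by
  classical
  induction S using Finset.strongInduction with
  | H S ih =>
    obtain ⟨a, ha⟩ := hS
    have ha' : SelArrow φ a a := Or.inl rfl
    let T := S.filter fun x => ¬ SelArrow φ a x
    have hTS : T ⊆ S := Finset.filter_subset _ _
    rcases T.eq_empty_or_nonempty with hT | hT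
    · refine ⟨a, ha, fun x hx => ⟨a, ha, ha', ?_⟩⟩
      by_contra h
      exact Finset.notMem_empty x (hT ▸ Finset.mem_filter.2 ⟨hx, h⟩)
    · have hlt : T ⊂ S :=
        (Finset.ssubset_iff_of_subset hTS).2
          ⟨a, ha, fun h => (Finset.mem_filter.1 h).2 ha'⟩
      obtain ⟨z, hz, hking⟩ := ih T hlt hT
      refine ⟨z, hTS hz, fun x hx => ?_⟩
      by_cases hax : SelArrow φ a x
      · exact ⟨a, ha, (hφ.selArrow_total a z).resolve_left (Finset.mem_filter.1 hz).2, hax⟩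
      · obtain ⟨y, hy, hzyx⟩ := hking x (Finset.mem_filter.2 ⟨hx, hax⟩)
        exact ⟨y, hTS hy, hzyx⟩

/-- The family `{K_{φ,x} : x ∈ X}` has the finite intersection property: for
every non-empty finite subset `S` of `X` the intersection of the sets
`K_{φ,x}`, `x ∈ S`, is non-empty. -/
theorem K_finite_intersection {X : Type*}
    (φ : X → X → X) (hφ : IsWeakSelection φ)
    (S : Finset X) (hS : S.Nonempty) :
    (⋂ x ∈ S, {z : X | ∃ y : X, SelArrow φ z y ∧ SelArrow φ y x}).Nonempty := by
  obtain ⟨z, -, hz⟩ := hφ.exists_king_finset S hS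
  refine ⟨z, Set.mem_iInter₂.2 fun x hx => ?_⟩
  obtain ⟨y, -, hy⟩ := hz x hx
  exact ⟨y, hy⟩
end

section
/- Let X be a topological space that admits at least one continuous weak selection and that is a king space. Then every non-empty clopen subset U of X (with the subspace topology) is a king space as well. -/
open Classical in
/-- The extension of a selection `φ` on `U` by a selection `ψ` on `X`: it agrees with `φ` on `U`,
with `ψ` on `Uᶜ`, and picks the point of `Uᶜ` from every mixed pair. -/
noncomputable def extendSel {X : Type*} (U : Set X) (φ : U → U → U) (ψ : X → X → X) (a b : X) : X :=
  if ha : a ∈ U then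
    if hb : b ∈ U then φ ⟨a, ha⟩ ⟨b, hb⟩ else b
  else if b ∈ U then a else ψ a b

section extendSel

variable {X : Type*} {U : Set X} {φ : U → U → U} {ψ : X → X → X} {a b : X}

theorem extendSel_of_mem_of_mem (ha : a ∈ U) (hb : b ∈ U) :
    extendSel U φ ψ a b = φ ⟨a, ha⟩ ⟨b, hb⟩ := by
  simp [extendSel, ha, hb]

theorem extendSel_of_mem_of_notMem (ha : a ∈ U) (hb : b ∉ U) : extendSel U φ ψ a b = b := by
  simp [extendSel, ha, hb]

theorem extendSel_of_notMem_of_mem (ha : a ∉ U) (hb : b ∈ U) : extendSel U φ ψ a b = a := by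
  simp [extendSel, ha, hb]

theorem extendSel_of_notMem_of_notMem (ha : a ∉ U) (hb : b ∉ U) :
    extendSel U φ ψ a b = ψ a b := by
  simp [extendSel, ha, hb]

theorem IsWeakSelection.extendSel (hφ : IsWeakSelection φ) (hψ : IsWeakSelection ψ) :
    IsWeakSelection (extendSel U φ ψ) := by
  refine ⟨fun a b => ?_, fun a b => ?_⟩ <;> by_cases ha : a ∈ U <;> by_cases hb : b ∈ U
  · rw [extendSel_of_mem_of_mem ha hb, extendSel_of_mem_of_mem hb ha, hφ.1]
  · rw [extendSel_of_mem_of_notMem ha hb, extendSel_of_notMem_of_mem hb ha]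
  · rw [extendSel_of_notMem_of_mem ha hb, extendSel_of_mem_of_notMem hb ha]
  · rw [extendSel_of_notMem_of_notMem ha hb, extendSel_of_notMem_of_notMem hb ha, hψ.1]
  · rw [extendSel_of_mem_of_mem ha hb]
    exact (hφ.2 ⟨a, ha⟩ ⟨b, hb⟩).imp (congrArg Subtype.val) (congrArg Subtype.val)
  · exact .inr (extendSel_of_mem_of_notMem ha hb)
  · exact .inl (extendSel_of_notMem_of_mem ha hb)
  · rw [extendSel_of_notMem_of_notMem ha hb]
    exact hψ.2 a b

theorem ContWeakSel.extendSel [TopologicalSpace X] (hU : IsClopen U) (hφ : ContWeakSel φ)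
    (hψ : ContWeakSel ψ) : ContWeakSel (extendSel U φ ψ) := by
  intro a b hab W hW hmem
  have hUc : IsOpen Uᶜ := hU.compl.isOpen
  by_cases ha : a ∈ U <;> by_cases hb : b ∈ U
  · rw [extendSel_of_mem_of_mem ha hb] at hmem
    obtain ⟨A, B, hA, hB, haA, hbB, h⟩ := hφ ⟨a, ha⟩ ⟨b, hb⟩ (by simpa using hab)
      (Subtype.val ⁻¹' W) (hW.preimage continuous_subtype_val) hmem
    refine ⟨Subtype.val '' A, Subtype.val '' B, hU.isOpen.isOpenMap_subtype_val A hA,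
      hU.isOpen.isOpenMap_subtype_val B hB, ⟨_, haA, rfl⟩, ⟨_, hbB, rfl⟩, ?_⟩
    rintro _ ⟨a', ha', rfl⟩ _ ⟨b', hb', rfl⟩ hne
    rw [extendSel_of_mem_of_mem a'.2 b'.2]
    exact h a' ha' b' hb' (ne_of_apply_ne _ hne)
  · rw [extendSel_of_mem_of_notMem ha hb] at hmem
    refine ⟨U, Uᶜ ∩ W, hU.isOpen, hUc.inter hW, ha, ⟨hb, hmem⟩, fun a' ha' b' hb' _ => ?_⟩
    rw [extendSel_of_mem_of_notMem ha' hb'.1]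
    exact hb'.2
  · rw [extendSel_of_notMem_of_mem ha hb] at hmem
    refine ⟨Uᶜ ∩ W, U, hUc.inter hW, hU.isOpen, ⟨ha, hmem⟩, hb, fun a' ha' b' hb' _ => ?_⟩
    rw [extendSel_of_notMem_of_mem ha'.1 hb']
    exact ha'.2
  · rw [extendSel_of_notMem_of_notMem ha hb] at hmem
    obtain ⟨A, B, hA, hB, haA, hbB, h⟩ := hψ a b hab W hW hmem
    refine ⟨Uᶜ ∩ A, Uᶜ ∩ B, hUc.inter hA, hUc.inter hB, ⟨ha, haA⟩, ⟨hb, hbB⟩,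
      fun a' ha' b' hb' hne => ?_⟩
    rw [extendSel_of_notMem_of_notMem ha'.1 hb'.1]
    exact h a' ha'.2 b' hb'.2 hne

theorem SelArrow.mem_of_extendSel (h : SelArrow (extendSel U φ ψ) a b) (hb : b ∈ U) : a ∈ U := by
  by_contra ha
  rcases h with rfl | ⟨hne, h⟩
  · exact ha hb
  · exact hne ((extendSel_of_notMem_of_mem ha hb).symm.trans h)

theorem SelArrow.of_extendSel {a b : U} (h : SelArrow (extendSel U φ ψ) a b) :
    SelArrow φ a b := by
  rcases h with h | ⟨hne, h⟩
  · exact .inl (Subtype.ext h)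
  · rw [extendSel_of_mem_of_mem a.2 b.2] at h
    exact .inr ⟨ne_of_apply_ne _ hne, Subtype.ext h⟩

end extendSel

/-- In a king space possessing a continuous weak selection, every non-empty
clopen subset is a king space (with the subspace topology). -/
theorem clopen_king_subspace {X : Type*} [TopologicalSpace X]
    (hsel : ∃ ψ : X → X → X, IsWeakSelection ψ ∧ ContWeakSel ψ)
    (hking : IsKingSpace X)
    (U : Set X) (hU : IsClopen U) (hUne : U.Nonempty) :
    IsKingSpace U := by
  intro φ hφ hφc
  obtain ⟨ψ, hψ, hψc⟩ := hsel
  obtain ⟨z, hz⟩ := hking (extendSel U φ ψ) (hφ.extendSel hψ) (hφc.extendSel hU hψc)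
  have hzU : z ∈ U := by
    obtain ⟨u, hu⟩ := hUne
    obtain ⟨y, hzy, hyu⟩ := hz u
    exact hzy.mem_of_extendSel (hyu.mem_of_extendSel hu)
  refine ⟨⟨z, hzU⟩, fun x => ?_⟩
  obtain ⟨y, hzy, hyx⟩ := hz x
  have hy : y ∈ U := hyx.mem_of_extendSel x.2
  exact ⟨⟨y, hy⟩, SelArrow.of_extendSel (a := ⟨z, hzU⟩) (b := ⟨y, hy⟩) hzy,
    SelArrow.of_extendSel (a := ⟨y, hy⟩) hyx⟩
end

section
/- Let Y be a linearly ordered topological space (a linear order whose topology is the order topology) and let X be a proper dense subspace of Y (with the subspace topology). Then X is not a king space; that is, there exists a continuous weak selection φ on X which has no φ-king. -/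
/-- A strict total order with open graph and no maximal element induces, by taking minima,
a continuous weak selection without a king. -/
theorem exists_contWeakSel_no_king {X : Type*} [TopologicalSpace X] (r : X → X → Prop)
    (hasymm : ∀ a b, r a b → ¬ r b a) (htrans : ∀ a b c, r a b → r b c → r a c)
    (htotal : ∀ a b, a ≠ b → r a b ∨ r b a) (hopen : IsOpen {q : X × X | r q.1 q.2})
    (hmax : ∀ z, ∃ x, r z x) :
    ∃ φ : X → X → X, IsWeakSelection φ ∧ ContWeakSel φ ∧ ∀ z : X, ¬ IsKing φ z := by
  classical
  have hlt : ∀ a b, SelArrow (fun a b => if r a b then a else b) a b → a = b ∨ r b a := by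
    rintro a b (h | ⟨hne, h⟩)
    · exact Or.inl h
    · by_cases hab : r a b
      · exact Or.inl (by simpa [hab] using h)
      · exact Or.inr ((htotal a b hne).resolve_left hab)
  refine ⟨fun a b => if r a b then a else b, ⟨fun a b => ?_, fun a b => ?_⟩, ?_, ?_⟩
  · by_cases hne : a = b
    · rw [hne]
    · rcases htotal a b hne with h | h <;> simp [h, hasymm _ _ h]
  · by_cases h : r a b <;> simp [h]
  · intro a b hne W hW hmem
    rcases htotal a b hne with h | h
    · have ha : a ∈ W := by simpa [h] using hmem
      obtain ⟨U, V, hU, hV, haU, hbV, hUV⟩ := isOpen_prod_iff.1 hopen a b h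
      refine ⟨U ∩ W, V, hU.inter hW, hV, ⟨haU, ha⟩, hbV, fun a' ha' b' hb' _ => ?_⟩
      have hr : r a' b' := hUV (Set.mk_mem_prod ha'.1 hb')
      simpa [hr] using ha'.2
    · have hb : b ∈ W := by simpa [hasymm _ _ h] using hmem
      obtain ⟨V, U, hV, hU, hbV, haU, hVU⟩ := isOpen_prod_iff.1 hopen b a h
      refine ⟨U, V ∩ W, hU, hV.inter hW, haU, ⟨hbV, hb⟩, fun a' ha' b' hb' _ => ?_⟩
      have hr : r b' a' := hVU (Set.mk_mem_prod hb'.1 ha')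
      simpa [hasymm _ _ hr] using hb'.2
  · intro z hz
    obtain ⟨x, hx⟩ := hmax z
    obtain ⟨y, hzy, hyx⟩ := hz x
    have hxz : x = z ∨ r x z := by
      rcases hlt z y hzy with rfl | h₁ <;> rcases hlt _ x hyx with rfl | h₂
      · exact Or.inl rfl
      · exact Or.inr h₂
      · exact Or.inr h₁
      · exact Or.inr (htrans _ _ _ h₂ h₁)
    rcases hxz with rfl | h
    · exact hasymm _ _ hx hx
    · exact hasymm _ _ hx h

/-- A point in the closure of `X` but outside `X` is approached by `X` from the left or from
the right. -/
theorem exists_between_of_mem_closure_of_notMem {Y : Type*} [TopologicalSpace Y] [LinearOrder Y]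
    [OrderTopology Y] {X : Set Y} {p : Y} (hp : p ∈ closure X) (hpX : p ∉ X) :
    ((∃ x ∈ X, x < p) ∧ ∀ x ∈ X, x < p → ∃ y ∈ X, x < y ∧ y < p) ∨
      ((∃ x ∈ X, p < x) ∧ ∀ x ∈ X, p < x → ∃ y ∈ X, p < y ∧ y < x) := by
  by_contra! h
  obtain ⟨hl, hr⟩ := h
  have hU : ∃ U : Set Y, IsOpen U ∧ p ∈ U ∧ ∀ y ∈ X, y ∈ U → p ≤ y := by
    by_cases hL : ∃ x ∈ X, x < p
    · obtain ⟨x, -, hxp, hx⟩ := hl hL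
      exact ⟨Set.Ioi x, isOpen_Ioi, hxp, hx⟩
    · push Not at hL
      exact ⟨Set.univ, isOpen_univ, trivial, fun y hy _ => hL y hy⟩
  have hV : ∃ V : Set Y, IsOpen V ∧ p ∈ V ∧ ∀ y ∈ X, y ∈ V → y ≤ p := by
    by_cases hR : ∃ x ∈ X, p < x
    · obtain ⟨x, -, hxp, hx⟩ := hr hR
      exact ⟨Set.Iio x, isOpen_Iio, hxp,
        fun y hy hyx => le_of_not_gt fun hpy => (hx y hy hpy).not_gt hyx⟩
    · push Not at hR
      exact ⟨Set.univ, isOpen_univ, trivial, fun y hy _ => hR y hy⟩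
  obtain ⟨U, hUo, hpU, hUX⟩ := hU
  obtain ⟨V, hVo, hpV, hVX⟩ := hV
  obtain ⟨y, ⟨hyU, hyV⟩, hyX⟩ := mem_closure_iff.1 hp (U ∩ V) (hUo.inter hVo) ⟨hpU, hpV⟩
  exact hpX (le_antisymm (hUX y hyX hyU) (hVX y hyX hyV) ▸ hyX)

/-- The order on a linear order cut at `p` in which the points above `p` precede those below. -/
def CutSwapLT {Y : Type*} [LinearOrder Y] (p a b : Y) : Prop :=
  (p < a ∧ b < p) ∨ (a < b ∧ b < p) ∨ (p < a ∧ a < b)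

theorem CutSwapLT.not_swap {Y : Type*} [LinearOrder Y] {p a b : Y} (h : CutSwapLT p a b) :
    ¬ CutSwapLT p b a := by
  unfold CutSwapLT at *
  grind

theorem CutSwapLT.trans {Y : Type*} [LinearOrder Y] {p a b c : Y} (hab : CutSwapLT p a b)
    (hbc : CutSwapLT p b c) : CutSwapLT p a c := by
  unfold CutSwapLT at *
  grind

theorem cutSwapLT_or_swap {Y : Type*} [LinearOrder Y] {p a b : Y} (ha : a ≠ p) (hb : b ≠ p)
    (hab : a ≠ b) : CutSwapLT p a b ∨ CutSwapLT p b a := by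
  unfold CutSwapLT
  grind

theorem isOpen_setOf_cutSwapLT {Y Z : Type*} [TopologicalSpace Y] [LinearOrder Y]
    [OrderTopology Y] [TopologicalSpace Z] (p : Y) {f g : Z → Y} (hf : Continuous f)
    (hg : Continuous g) : IsOpen {q | CutSwapLT p (f q) (g q)} :=
  ((isOpen_lt continuous_const hf).inter (isOpen_lt hg continuous_const)).union
    (((isOpen_lt hf hg).inter (isOpen_lt hg continuous_const)).union
      ((isOpen_lt continuous_const hf).inter (isOpen_lt hf hg)))

/-- No proper dense subspace of a linearly ordered topological space is a king
space: it carries a continuous weak selection with no king. -/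
theorem proper_dense_not_king {Y : Type*} [TopologicalSpace Y] [LinearOrder Y]
    [OrderTopology Y] (X : Set Y) (hd : Dense X) (hp : X ≠ Set.univ) :
    ∃ φ : X → X → X, IsWeakSelection φ ∧ ContWeakSel φ ∧
      ∀ z : X, ¬ IsKing φ z := by
  obtain ⟨p, hpX⟩ := (Set.ne_univ_iff_exists_notMem X).1 hp
  have hne : ∀ a : X, (a : Y) ≠ p := fun a h => hpX (h ▸ a.2)
  have htotal : ∀ a b : X, a ≠ b → CutSwapLT p (a : Y) b ∨ CutSwapLT p (b : Y) a :=
    fun a b hab => cutSwapLT_or_swap (hne a) (hne b) (Subtype.coe_ne_coe.2 hab)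
  have hfst : Continuous fun q : X × X => (q.1 : Y) := by fun_prop
  have hsnd : Continuous fun q : X × X => (q.2 : Y) := by fun_prop
  rcases exists_between_of_mem_closure_of_notMem (hd p) hpX with
    ⟨⟨x, hx, hxp⟩, h⟩ | ⟨⟨x, hx, hpx⟩, h⟩
  · refine exists_contWeakSel_no_king (fun a b : X => CutSwapLT p (a : Y) b)
      (fun _ _ => CutSwapLT.not_swap) (fun _ _ _ => CutSwapLT.trans) htotal
      (isOpen_setOf_cutSwapLT p hfst hsnd) fun z => ?_
    rcases lt_or_gt_of_ne (hne z) with hz | hz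
    · obtain ⟨y, hy, hzy, hyp⟩ := h z z.2 hz
      exact ⟨⟨y, hy⟩, Or.inr (Or.inl ⟨hzy, hyp⟩)⟩
    · exact ⟨⟨x, hx⟩, Or.inl ⟨hz, hxp⟩⟩
  · refine exists_contWeakSel_no_king (fun a b : X => CutSwapLT p (b : Y) a)
      (fun _ _ => CutSwapLT.not_swap) (fun _ _ _ hab hbc => hbc.trans hab)
      (fun a b hab => (htotal a b hab).symm) (isOpen_setOf_cutSwapLT p hsnd hfst) fun z => ?_
    rcases lt_or_gt_of_ne (hne z) with hz | hz
    · exact ⟨⟨x, hx⟩, Or.inl ⟨hpx, hz⟩⟩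
    · obtain ⟨y, hy, hpy, hyz⟩ := h z z.2 hz
      exact ⟨⟨y, hy⟩, Or.inr (Or.inr ⟨hpy, hyz⟩)⟩
end

section
/- Let X be a linearly ordered topological space (a linear order whose topology is the order topology). If X is a king space, then X is compact. -/
/-- A jointly continuous selection is continuous as a weak selection. -/
theorem contWeakSel_of_continuous {X : Type*} [TopologicalSpace X] {φ : X → X → X}
    (h : Continuous fun p : X × X => φ p.1 p.2) : ContWeakSel φ := by
  intro a b _ W hW hab
  obtain ⟨U, V, hU, hV, ha, hb, hUV⟩ := isOpen_prod_iff.1 (hW.preimage h) a b hab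
  exact ⟨U, V, hU, hV, ha, hb, fun a' ha' b' hb' _ => hUV (Set.mk_mem_prod ha' hb')⟩

/-- In a linearly ordered king space, a nonempty clopen lower set has a greatest element: otherwise,
choosing the minimum of two points on the same side of the set and the maximum of two points
separated by it leaves no king. -/
theorem IsKingSpace.exists_isGreatest {X : Type*} [TopologicalSpace X] [LinearOrder X]
    [OrderTopology X] (hking : IsKingSpace X) {A : Set X} (hA : IsClopen A) (hlow : IsLowerSet A)
    (hne : A.Nonempty) : ∃ z, IsGreatest A z := by
  classical
  let φ : X → X → X := fun a b => if (a ∈ A ↔ b ∈ A) then min a b else max a b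
  have hclopen : IsClopen {p : X × X | p.1 ∈ A ↔ p.2 ∈ A} := by
    have : {p : X × X | p.1 ∈ A ↔ p.2 ∈ A} = A ×ˢ A ∪ Aᶜ ×ˢ Aᶜ := by
      ext p
      simp only [Set.mem_ofPred_eq, Set.mem_union, Set.mem_prod, Set.mem_compl_iff]
      tauto
    rw [this]
    exact (hA.prod hA).union (hA.compl.prod hA.compl)
  have hcont : Continuous fun p : X × X => φ p.1 p.2 :=
    Continuous.if (fun p hp => by simp [hclopen.frontier_eq] at hp)
      (continuous_fst.min continuous_snd) (continuous_fst.max continuous_snd)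
  have hsel : IsWeakSelection φ := by
    refine ⟨fun a b => ?_, fun a b => ?_⟩
    · simp only [φ, min_comm a b, max_comm a b, iff_comm (a := a ∈ A)]
    · simp only [φ]
      split_ifs
      · exact min_choice a b
      · exact max_choice a b
  obtain ⟨z, hz⟩ := hking φ hsel (contWeakSel_of_continuous hcont)
  have escape : ∀ {a b : X}, a ∉ A → SelArrow φ a b → b ∉ A := by
    rintro a b ha (rfl | ⟨hab, h⟩) hb
    · exact ha hb
    · simp only [φ, ha, hb, false_iff, not_true_eq_false, if_false] at h
      exact ha (hlow (max_eq_right_iff.1 h) hb)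
  have descend : ∀ {a b : X}, a ∈ A → b ∈ A → SelArrow φ a b → b ≤ a := by
    rintro a b ha hb (rfl | ⟨hab, h⟩)
    · exact le_rfl
    · simpa only [φ, ha, hb, iff_self, if_true, min_eq_right_iff] using h
  have hzA : z ∈ A := by
    by_contra hzA
    obtain ⟨x, hx⟩ := hne
    obtain ⟨y, hzy, hyx⟩ := hz x
    exact escape (escape hzA hzy) hyx hx
  refine ⟨z, hzA, fun x hx => ?_⟩
  obtain ⟨y, hzy, hyx⟩ := hz x
  have hy : y ∈ A := by
    by_contra hy
    exact escape hy hyx hx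
  exact (descend hy hx hyx).trans (descend hzA hy hzy)

/-- Every nonempty subset of a linearly ordered king space has a least upper bound. -/
theorem IsKingSpace.exists_isLUB {X : Type*} [TopologicalSpace X] [LinearOrder X]
    [OrderTopology X] (hking : IsKingSpace X) {S : Set X} (hS : S.Nonempty) :
    ∃ c, IsLUB S c := by
  by_contra! hno
  have hlt : ∀ s ∈ S, ∃ t ∈ S, s < t := by
    intro s hs
    by_contra! h
    exact hno s (IsGreatest.isLUB ⟨hs, h⟩)
  let A : Set X := lowerClosure S
  have hopen : IsOpen A := by
    refine isOpen_iff_mem_nhds.2 ?_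
    rintro x ⟨s, hs, hxs⟩
    obtain ⟨t, ht, hst⟩ := hlt s hs
    exact Filter.mem_of_superset (Iio_mem_nhds (hxs.trans_lt hst)) fun y hy => ⟨t, ht, hy.le⟩
  have hclosed : IsClosed A := by
    refine isOpen_compl_iff.1 (isOpen_iff_mem_nhds.2 fun x hx => ?_)
    have hxub : x ∈ upperBounds S := fun s hs => le_of_not_ge fun h => hx ⟨s, hs, h⟩
    obtain ⟨u, hu, hux⟩ : ∃ u ∈ upperBounds S, u < x := by
      by_contra! h
      exact hno x ⟨hxub, h⟩
    refine Filter.mem_of_superset (Ioi_mem_nhds hux) ?_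
    rintro y hy ⟨s, hs, hys⟩
    exact (hy.trans_le hys).not_ge (hu hs)
  obtain ⟨z, ⟨s, hs, hzs⟩, hz⟩ := hking.exists_isGreatest ⟨hclosed, hopen⟩
    (lowerClosure S).lower (hS.mono subset_lowerClosure)
  obtain ⟨t, ht, hst⟩ := hlt s hs
  exact (hzs.trans_lt hst).not_ge (hz (subset_lowerClosure ht))

/-- A linearly ordered king space has a least element. -/
theorem IsKingSpace.exists_isBot {X : Type*} [TopologicalSpace X] [LinearOrder X]
    [OrderTopology X] (hking : IsKingSpace X) : ∃ z : X, IsBot z := by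
  obtain ⟨z, hz⟩ := hking max ⟨max_comm, max_choice⟩ (contWeakSel_of_continuous continuous_max)
  have hle : ∀ {a b : X}, SelArrow max a b → a ≤ b := by
    rintro a b (rfl | ⟨-, h⟩)
    · exact le_rfl
    · exact max_eq_right_iff.1 h
  refine ⟨z, fun x => ?_⟩
  obtain ⟨y, hzy, hyx⟩ := hz x
  exact (hle hzy).trans (hle hyx)

/-- A linearly ordered king space is compact. -/
theorem linearly_ordered_king_compact {X : Type*} [TopologicalSpace X]
    [LinearOrder X] [OrderTopology X] (hking : IsKingSpace X) :
    CompactSpace X := by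
  refine ⟨isCompact_iff_ultrafilter_le_nhds.2 fun f _ => ?_⟩
  obtain ⟨m, hm⟩ := hking.exists_isBot
  let S : Set X := {x | Set.Ici x ∈ f}
  have hmS : m ∈ S := Filter.mem_of_superset Filter.univ_mem fun x _ => hm x
  obtain ⟨c, hc⟩ := hking.exists_isLUB ⟨m, hmS⟩
  refine ⟨c, Set.mem_univ c, ?_⟩
  rw [nhds_eq_order]
  refine le_inf (le_iInf₂ fun a ha => Filter.le_principal_iff.2 ?_)
    (le_iInf₂ fun b hb => Filter.le_principal_iff.2 ?_)
  · obtain ⟨s, hs, has⟩ := (lt_isLUB_iff hc).1 ha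
    exact Filter.mem_of_superset hs fun x hx => has.trans_le hx
  · by_contra h
    have hbS : Set.Ici b ∈ f := by
      rw [← Set.compl_Iio]
      exact Ultrafilter.compl_mem_iff_notMem.2 h
    exact (hc.1 hbS).not_gt hb
end

section
/- Let X be a topological space that admits at least one continuous weak selection. If X admits a partition {U_n : n ∈ ℕ} into countably many pairwise disjoint non-empty open sets whose union is X, then X is not a king space; that is, there exists a continuous weak selection φ on X which has no φ-king. -/
/-- The selection that picks the point of smaller index, and follows `ψ` on points of equal index. -/
def lexSelection {X : Type*} (f : X → ℕ) (ψ : X → X → X) (a b : X) : X :=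
  if f a < f b then a else if f b < f a then b else ψ a b

theorem lexSelection_isWeakSelection {X : Type*} (f : X → ℕ) {ψ : X → X → X}
    (hψ : IsWeakSelection ψ) : IsWeakSelection (lexSelection f ψ) := by
  refine ⟨fun a b => ?_, fun a b => ?_⟩
  · have := hψ.1 a b
    grind [lexSelection]
  · have := hψ.2 a b
    grind [lexSelection]

theorem lexSelection_contWeakSel {X : Type*} [TopologicalSpace X] {f : X → ℕ}
    (hf : Continuous f) {ψ : X → X → X} (hψ : ContWeakSel ψ) :
    ContWeakSel (lexSelection f ψ) := by
  have hfib : ∀ x, IsOpen (f ⁻¹' {f x}) := fun x => (isOpen_discrete _).preimage hf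
  intro a b hab W hW hmem
  rcases lt_trichotomy (f a) (f b) with h | h | h
  · refine ⟨f ⁻¹' {f a} ∩ W, f ⁻¹' {f b}, (hfib a).inter hW, hfib b,
      ⟨rfl, by simpa [lexSelection, h] using hmem⟩, rfl, ?_⟩
    rintro a' ⟨ha', haW⟩ b' hb' -
    rw [Set.mem_preimage, Set.mem_singleton_iff] at ha' hb'
    simpa [lexSelection, ha', hb', h] using haW
  · obtain ⟨U, V, hU, hV, haU, hbV, hUV⟩ :=
      hψ a b hab W hW (by simpa [lexSelection, h] using hmem)
    refine ⟨f ⁻¹' {f a} ∩ U, f ⁻¹' {f b} ∩ V, (hfib a).inter hU, (hfib b).inter hV,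
      ⟨rfl, haU⟩, ⟨rfl, hbV⟩, ?_⟩
    rintro a' ⟨ha', haU'⟩ b' ⟨hb', hbV'⟩ hne
    rw [Set.mem_preimage, Set.mem_singleton_iff] at ha' hb'
    simpa [lexSelection, ha', hb', h] using hUV a' haU' b' hbV' hne
  · refine ⟨f ⁻¹' {f a}, f ⁻¹' {f b} ∩ W, hfib a, (hfib b).inter hW, rfl,
      ⟨rfl, by simpa [lexSelection, h, h.not_gt] using hmem⟩, ?_⟩
    rintro a' ha' b' ⟨hb', hbW⟩ -
    rw [Set.mem_preimage, Set.mem_singleton_iff] at ha' hb'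
    simpa [lexSelection, ha', hb', h, h.not_gt] using hbW

theorem SelArrow.le_of_lexSelection {X : Type*} {f : X → ℕ} {ψ : X → X → X} {a b : X}
    (h : SelArrow (lexSelection f ψ) a b) : f b ≤ f a := by
  grind [SelArrow, lexSelection]

theorem not_isKing_lexSelection {X : Type*} {f : X → ℕ} (hf : Function.Surjective f)
    (ψ : X → X → X) (z : X) : ¬ IsKing (lexSelection f ψ) z := by
  intro hz
  obtain ⟨x, hx⟩ := hf (f z + 1)
  obtain ⟨y, hzy, hyx⟩ := hz x
  have := hyx.le_of_lexSelection.trans hzy.le_of_lexSelection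
  omega

/-- A space with a continuous weak selection which admits a partition into
countably many pairwise disjoint non-empty open sets is not a king space. -/
theorem countable_partition_not_king {X : Type*} [TopologicalSpace X]
    (hsel : ∃ ψ : X → X → X, IsWeakSelection ψ ∧ ContWeakSel ψ)
    (U : ℕ → Set X) (hopen : ∀ n, IsOpen (U n))
    (hne : ∀ n, (U n).Nonempty)
    (hdisj : ∀ m n : ℕ, m ≠ n → Disjoint (U m) (U n))
    (hcover : ⋃ n, U n = Set.univ) :
    ∃ φ : X → X → X, IsWeakSelection φ ∧ ContWeakSel φ ∧
      ∀ z : X, ¬ IsKing φ z := by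
  obtain ⟨ψ, hψ, hψc⟩ := hsel
  choose f hf using fun x => Set.mem_iUnion.1 (hcover ▸ Set.mem_univ x)
  have huniq : ∀ x n, x ∈ U n → f x = n := fun x n hx => by
    by_contra hn
    exact Set.disjoint_left.1 (hdisj _ _ hn) (hf x) hx
  have hcont : Continuous f := continuous_discrete_rng.2 fun n => by
    have : f ⁻¹' {n} = U n := Set.ext fun x => ⟨fun hx => hx ▸ hf x, huniq x n⟩
    exact this ▸ hopen n
  have hsurj : Function.Surjective f := fun n => (hne n).imp fun x => huniq x n
  exact ⟨lexSelection f ψ, lexSelection_isWeakSelection f hψ,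
    lexSelection_contWeakSel hcont hψc, not_isKing_lexSelection hsurj ψ⟩
end

section
/- Let X be a Tychonoff space (completely regular Hausdorff) that admits at least one continuous weak selection and is a king space. If X is pseudocompact (every continuous real-valued function on X is bounded), then X is compact. -/
open Filter Topology Set

/-- A tournament on the points of a space which is open as a subset of the square. -/
structure IsOpenTournament {X : Type*} [TopologicalSpace X] (R : X → X → Prop) : Prop where
  asymm : ∀ a b, R a b → ¬ R b a
  total : ∀ a b, a ≠ b → R a b ∨ R b a
  isOpen : IsOpen {p : X × X | R p.1 p.2}

/-- Every sequence of nonempty open sets has a cluster point. -/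
def HasOpenClusterPoints (X : Type*) [TopologicalSpace X] : Prop :=
  ∀ U : ℕ → Set X, (∀ n, IsOpen (U n)) → (∀ n, (U n).Nonempty) →
    ∃ x, ∀ N ∈ 𝓝 x, ∃ᶠ n in atTop, (U n ∩ N).Nonempty

section

variable {X : Type*} [TopologicalSpace X]

theorem hasOpenClusterPoints_of_pseudocompact [CompletelyRegularSpace X]
    (hpseudo : ∀ f : X → ℝ, Continuous f → ∃ M : ℝ, ∀ x : X, |f x| ≤ M) :
    HasOpenClusterPoints X := by
  intro U hU hne
  by_contra! hcon
  have hlf : LocallyFinite U := by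
    intro x
    obtain ⟨N, hN, h⟩ := hcon x
    refine ⟨N, hN, ?_⟩
    rw [← Nat.cofinite_eq_atTop, eventually_cofinite] at h
    simpa only [nonempty_iff_ne_empty] using h
  choose x hx using hne
  have hf : ∀ n, ∃ f : X → ℝ, Continuous f ∧ f (x n) = n ∧ (∀ y, 0 ≤ f y) ∧
      Function.support f ⊆ U n := by
    intro n
    obtain ⟨g, hg, hg0, hg1⟩ := completelyRegularSpace_iff_isOpen.1 inferInstance (x n) (U n)
      (hU n) (hx n)
    refine ⟨fun y => n * (1 - (g y : ℝ)), by fun_prop, by simp [hg0], fun y => ?_, ?_⟩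
    · exact mul_nonneg n.cast_nonneg (sub_nonneg.2 (g y).2.2)
    · intro y hy
      by_contra hyU
      exact hy (by simp [hg1 hyU])
  choose f hfc hfx hf0 hfs using hf
  have hlf' : LocallyFinite fun n => Function.support (f n) := hlf.subset hfs
  obtain ⟨M, hM⟩ := hpseudo (fun y => ∑ᶠ n, f n y) (continuous_finsum hfc hlf')
  obtain ⟨n, hn⟩ := exists_nat_gt M
  have hle : f n (x n) ≤ ∑ᶠ m, f m (x n) :=
    single_le_finsum n (hlf'.point_finite (x n)) fun m => hf0 m _
  have := (le_abs_self _).trans (hM (x n))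
  rw [hfx] at hle
  linarith

namespace IsOpenTournament

variable {R : X → X → Prop}

theorem irrefl (hR : IsOpenTournament R) (a : X) : ¬ R a a := fun h => hR.asymm a a h h

theorem swap (hR : IsOpenTournament R) : IsOpenTournament fun a b => R b a where
  asymm a b := hR.asymm b a
  total a b h := hR.total b a h.symm
  isOpen := hR.isOpen.preimage continuous_swap

theorem exists_open (hR : IsOpenTournament R) {a b : X} (h : R a b) :
    ∃ U V : Set X, IsOpen U ∧ IsOpen V ∧ a ∈ U ∧ b ∈ V ∧ ∀ u ∈ U, ∀ v ∈ V, R u v := by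
  obtain ⟨U, V, hU, hV, ha, hb, hUV⟩ := isOpen_prod_iff.1 hR.isOpen a b h
  exact ⟨U, V, hU, hV, ha, hb, fun u hu v hv => hUV (mk_mem_prod hu hv)⟩

theorem isOpen_left (hR : IsOpenTournament R) (z : X) : IsOpen {x | R x z} :=
  hR.isOpen.preimage (by fun_prop : Continuous fun x => (x, z))

theorem isOpen_right (hR : IsOpenTournament R) (z : X) : IsOpen {x | R z x} :=
  hR.swap.isOpen_left z

/-- A decreasing sequence of open sets accumulates at a single point. -/
theorem eventually_inter_nonempty (hR : IsOpenTournament R) (hX : HasOpenClusterPoints X)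
    {W : ℕ → Set X} (hW : ∀ n, IsOpen (W n)) (hne : ∀ n, (W n).Nonempty)
    (hmono : ∀ m n, m < n → ∀ a ∈ W m, ∀ b ∈ W n, R b a) :
    ∃ x, ∀ N ∈ 𝓝 x, ∀ᶠ n in atTop, (W n ∩ N).Nonempty := by
  have huniq : ∀ x y, (∀ N ∈ 𝓝 x, ∃ᶠ n in atTop, (W n ∩ N).Nonempty) →
      (∀ N ∈ 𝓝 y, ∃ᶠ n in atTop, (W n ∩ N).Nonempty) → ¬ R x y := by
    intro x y hx hy hxy
    obtain ⟨U, V, hU, hV, hxU, hyV, hUV⟩ := hR.exists_open hxy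
    obtain ⟨m, u, huW, huU⟩ := (hx U (hU.mem_nhds hxU)).exists
    obtain ⟨n, hmn, v, hvW, hvV⟩ := frequently_atTop.1 (hy V (hV.mem_nhds hyV)) (m + 1)
    exact hR.asymm _ _ (hUV u huU v hvV) (hmono m n hmn u huW v hvW)
  obtain ⟨x, hx⟩ := hX W hW hne
  refine ⟨x, fun N hN => ?_⟩
  by_contra hcon
  obtain ⟨k, hk, hkN⟩ := extraction_of_frequently_atTop (not_eventually.1 hcon)
  obtain ⟨y, hy⟩ := hX (W ∘ k) (fun n => hW _) (fun n => hne _)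
  have hy' : ∀ N ∈ 𝓝 y, ∃ᶠ n in atTop, (W n ∩ N).Nonempty := fun M hM =>
    hk.tendsto_atTop.frequently (hy M hM)
  have hne : x ≠ y := by
    rintro rfl
    obtain ⟨n, hn⟩ := (hy N hN).exists
    exact hkN n hn
  rcases hR.total x y hne with h | h
  · exact huniq x y hx hy' h
  · exact huniq y x hy' hx h

theorem exists_subseq_of_frequently (hR : IsOpenTournament R) (hX : HasOpenClusterPoints X)
    {U : ℕ → Set X} (hU : ∀ n, IsOpen (U n)) {x : X}
    (hx : ∀ N ∈ 𝓝 x, ∃ᶠ n in atTop, ({y ∈ U n | R x y} ∩ N).Nonempty) :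
    ∃ (k : ℕ → ℕ) (W : ℕ → Set X), StrictMono k ∧ (∀ n, W n ⊆ U (k n)) ∧
      ∃ y, ∀ N ∈ 𝓝 y, ∀ᶠ n in atTop, (W n ∩ N).Nonempty := by
  classical
  obtain ⟨f, hf, hr⟩ := exists_seq_of_forall_finset_exists
    (fun p : ℕ × Set X × Set X => (IsOpen p.2.1 ∧ p.2.1.Nonempty ∧ p.2.1 ⊆ U p.1) ∧
      p.2.2 ∈ 𝓝 x ∧ ∀ g ∈ p.2.2, ∀ w ∈ p.2.1, R g w)
    (fun p q => p.1 < q.1 ∧ q.2.1 ⊆ p.2.2) (by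
      intro s hs
      have hG : (⋂ p ∈ s, p.2.2) ∈ 𝓝 x := (biInter_finset_mem s).2 fun p hp => (hs p hp).2.1
      obtain ⟨n, hn, y, ⟨hyU, hxy⟩, hyG⟩ :=
        frequently_atTop.1 (hx _ (interior_mem_nhds.2 hG)) (s.sup Prod.fst + 1)
      obtain ⟨G, W, hGo, hWo, hxG, hyW, hGW⟩ := hR.exists_open hxy
      refine ⟨(n, W ∩ (U n ∩ interior (⋂ p ∈ s, p.2.2)), G),
        ⟨⟨hWo.inter ((hU n).inter isOpen_interior), ⟨y, hyW, hyU, hyG⟩, fun w hw => hw.2.1⟩,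
          hGo.mem_nhds hxG, fun g hg w hw => hGW g hg w hw.1⟩, fun p hp => ⟨?_, ?_⟩⟩
      · exact (Finset.le_sup (f := Prod.fst) hp).trans_lt hn
      · exact fun w hw => mem_iInter₂.1 (interior_subset hw.2.2) p hp)
  refine ⟨fun n => (f n).1, fun n => (f n).2.1, fun m n h => (hr m n h).1,
    fun n => (hf n).1.2.2, hR.eventually_inter_nonempty hX (fun n => (hf n).1.1)
      (fun n => (hf n).1.2.1) fun m n h a ha b hb => (hf m).2.2 b ((hr m n h).2 hb) a ha⟩

/-- After passing to a subsequence and shrinking, open sets converge to a point. -/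
theorem exists_subseq (hR : IsOpenTournament R) (hX : HasOpenClusterPoints X)
    {U : ℕ → Set X} (hU : ∀ n, IsOpen (U n)) (hne : ∀ n, (U n).Nonempty) :
    ∃ (k : ℕ → ℕ) (W : ℕ → Set X), StrictMono k ∧ (∀ n, W n ⊆ U (k n)) ∧
      ∃ y, ∀ N ∈ 𝓝 y, ∀ᶠ n in atTop, (W n ∩ N).Nonempty := by
  obtain ⟨x, hx⟩ := hX U hU hne
  by_cases hfreq : ∃ᶠ n in atTop, x ∈ U n
  · obtain ⟨k, hk, hkx⟩ := extraction_of_frequently_atTop hfreq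
    exact ⟨k, U ∘ k, hk, fun n => Subset.rfl, x, fun N hN =>
      Eventually.of_forall fun n => ⟨x, hkx n, mem_of_mem_nhds hN⟩⟩
  by_cases h1 : ∀ N ∈ 𝓝 x, ∃ᶠ n in atTop, ({y ∈ U n | R x y} ∩ N).Nonempty
  · exact hR.exists_subseq_of_frequently hX hU h1
  refine hR.swap.exists_subseq_of_frequently hX hU (x := x) fun N hN => ?_
  push Not at h1
  obtain ⟨M, hM, h1⟩ := h1
  refine ((hx _ (inter_mem hN hM)).and_eventually
    (h1.and (not_frequently.1 hfreq))).mono ?_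
  rintro n ⟨⟨y, hyU, hyN, hyM⟩, hemp, hxn⟩
  refine ⟨y, ⟨hyU, ?_⟩, hyN⟩
  refine (hR.total x y (by rintro rfl; exact hxn hyU)).resolve_left fun h => ?_
  exact (Set.ext_iff.1 hemp y).1 ⟨⟨hyU, h⟩, hyM⟩

theorem false_of_alternating (hR : IsOpenTournament R) (hX : HasOpenClusterPoints X)
    {F : Filter X} {C D : Set X} (hCD : Disjoint (closure C) (closure D))
    (h : ∀ G ∈ F, IsOpen G → ∃ V W : Set X, IsOpen V ∧ V.Nonempty ∧ V ⊆ C ∩ G ∧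
      IsOpen W ∧ W.Nonempty ∧ W ⊆ D ∧ (∀ w ∈ W, ∀ v ∈ V, R w v) ∧
      ∃ G' ∈ F, IsOpen G' ∧ ∀ g ∈ G', ∀ w ∈ W, R g w) : False := by
  classical
  obtain ⟨f, hf, hr⟩ := exists_seq_of_forall_finset_exists
    (fun p : Set X × Set X × Set X => (IsOpen p.1 ∧ p.1.Nonempty ∧ p.1 ⊆ C) ∧
      (IsOpen p.2.1 ∧ p.2.1.Nonempty ∧ p.2.1 ⊆ D) ∧ (∀ w ∈ p.2.1, ∀ v ∈ p.1, R w v) ∧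
      p.2.2 ∈ F ∧ IsOpen p.2.2 ∧ ∀ g ∈ p.2.2, ∀ w ∈ p.2.1, R g w)
    (fun p q => q.1 ⊆ p.2.2) (by
      intro s hs
      obtain ⟨V, W, hV, hVne, hVs, hW, hWne, hWs, hWV, G, hGF, hG, hGW⟩ :=
        h (⋂ p ∈ s, p.2.2) ((biInter_finset_mem s).2 fun p hp => (hs p hp).2.2.2.1)
          (isOpen_biInter_finset fun p hp => (hs p hp).2.2.2.2.1)
      exact ⟨(V, W, G), ⟨⟨hV, hVne, fun v hv => (hVs hv).1⟩, ⟨hW, hWne, hWs⟩, hWV, hGF, hG, hGW⟩,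
        fun p hp v hv => mem_iInter₂.1 (hVs hv).2 p hp⟩)
  obtain ⟨k, W, hk, hWk, y, hy⟩ := hR.exists_subseq hX (U := fun n => (f n).2.1)
    (fun n => (hf n).2.1.1) (fun n => (hf n).2.1.2.1)
  obtain ⟨x, hx⟩ := hX (fun n => (f (k n)).1) (fun n => (hf _).1.1) (fun n => (hf _).1.2.1)
  have hxC : x ∈ closure C := mem_closure_iff_nhds.2 fun N hN => by
    obtain ⟨n, v, hv, hvN⟩ := (hx N hN).exists
    exact ⟨v, hvN, (hf _).1.2.2 hv⟩
  have hyD : y ∈ closure D := mem_closure_iff_nhds.2 fun N hN => by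
    obtain ⟨n, w, hw, hwN⟩ := (hy N hN).exists
    exact ⟨w, hwN, (hf _).2.1.2.2 (hWk n hw)⟩
  have hne : x ≠ y := by
    rintro rfl
    exact disjoint_left.1 hCD hxC hyD
  rcases hR.total x y hne with hxy | hyx
  · obtain ⟨G, H, hG, hH, hxG, hyH, hGH⟩ := hR.exists_open hxy
    obtain ⟨n, ⟨v, hv, hvG⟩, w, hw, hwH⟩ :=
      ((hx G (hG.mem_nhds hxG)).and_eventually (hy H (hH.mem_nhds hyH))).exists
    exact hR.asymm _ _ (hGH v hvG w hwH) ((hf _).2.2.1 w (hWk n hw) v hv)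
  · obtain ⟨H, G, hH, hG, hyH, hxG, hHG⟩ := hR.exists_open hyx
    obtain ⟨m, w, hw, hwH⟩ := (hy H (hH.mem_nhds hyH)).exists
    obtain ⟨n, hmn, v, hv, hvG⟩ := frequently_atTop.1 (hx G (hG.mem_nhds hxG)) (m + 1)
    exact hR.asymm _ _ (hHG w hwH v hvG)
      ((hf _).2.2.2.2.2 v (hr _ _ (hk hmn) hv) w (hWk m hw))

/-- Away from `x`, the relation to `x` is locally uniform at `x`. -/
theorem eventually_forall_notMem [RegularSpace X] (hR : IsOpenTournament R)
    (hX : HasOpenClusterPoints X) {x : X} {N : Set X} (hN : N ∈ 𝓝 x) :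
    ∀ᶠ x' in 𝓝 x, ∀ y ∉ N, R x y → R x' y := by
  by_contra hcon
  obtain ⟨N₂, hN₂, hN₂c, hN₂s⟩ := exists_mem_nhds_isClosed_subset hN
  obtain ⟨N₁, hN₁, hN₁c, hN₁s⟩ := exists_mem_nhds_isClosed_subset (interior_mem_nhds.2 hN₂)
  refine hR.false_of_alternating hX (F := 𝓝 x) (C := N₁) (D := N₂ᶜ) ?_ ?_
  · rw [closure_compl, hN₁c.closure_eq]
    exact disjoint_compl_right.mono_left hN₁s
  intro G hG hGo
  obtain ⟨x', hx', hx'G⟩ := ((not_eventually.1 hcon).and_eventually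
    (inter_mem (interior_mem_nhds.2 hN₁) hG)).exists
  push Not at hx'
  obtain ⟨y, hyN, hxy, hx'y⟩ := hx'
  have hne : x' ≠ y := by
    rintro rfl
    exact hyN (hN₂s (interior_subset (hN₁s (interior_subset hx'G.1))))
  obtain ⟨W, V, hW, hV, hyW, hxV, hWV⟩ := hR.exists_open ((hR.total _ _ hne).resolve_left hx'y)
  obtain ⟨G', W', hG', hW', hxG', hyW', hGW'⟩ := hR.exists_open hxy
  exact ⟨V ∩ (interior N₁ ∩ G), W ∩ W' ∩ N₂ᶜ, hV.inter (isOpen_interior.inter hGo),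
    ⟨x', hxV, hx'G⟩, fun v hv => ⟨interior_subset hv.2.1, hv.2.2⟩,
    (hW.inter hW').inter hN₂c.isOpen_compl, ⟨y, ⟨hyW, hyW'⟩, fun hy => hyN (hN₂s hy)⟩,
    fun w hw => hw.2, fun w hw v hv => hWV w hw.1.1 v hv.1, G', hG'.mem_nhds hxG', hG',
    fun g hg w hw => hGW' g hg w hw.1.2⟩

/-- If a free filter dominates every point, then no point is a king. -/
theorem exists_not_reachable [RegularSpace X] (hR : IsOpenTournament R)
    (hX : HasOpenClusterPoints X) {F : Filter X} [F.NeBot]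
    (hfree : ∀ x, ∃ N ∈ 𝓝 x, Nᶜ ∈ F) (hdom : ∀ z, ∀ᶠ y in F, R y z) (z : X) :
    ∃ x, ∀ y, (z = y ∨ R z y) → ¬ (y = x ∨ R y x) := by
  by_contra! hcon
  have hfree' : ∀ x, ∃ N ∈ 𝓝 x, IsClosed N ∧ Nᶜ ∈ F := by
    intro x
    obtain ⟨N, hN, hNF⟩ := hfree x
    obtain ⟨M, hM, hMc, hMN⟩ := exists_mem_nhds_isClosed_subset hN
    exact ⟨M, hM, hMc, mem_of_superset hNF (compl_subset_compl.2 hMN)⟩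
  obtain ⟨N, hN, hNc, hNF⟩ := hfree' z
  refine hR.false_of_alternating hX (F := F) (C := {x | R x z} ∩ Nᶜ) (D := {y | R z y}) ?_ ?_
  · refine disjoint_left.2 fun x hxC hxD => ?_
    have hxz : x ≠ z := by
      rintro rfl
      obtain ⟨y, hyN, hy⟩ := mem_closure_iff_nhds.1 hxC N hN
      exact hy.2 hyN
    rcases hR.total x z hxz with h | h
    · obtain ⟨y, hy, hy'⟩ := mem_closure_iff.1 hxD _ (hR.isOpen_left z) h
      exact hR.asymm _ _ hy hy'
    · obtain ⟨y, hy, hy'⟩ := mem_closure_iff.1 hxC _ (hR.isOpen_right z) h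
      exact hR.asymm _ _ hy hy'.1
  intro G hG hGo
  obtain ⟨x, ⟨hxz, hxN⟩, hxG⟩ := F.nonempty_of_mem (inter_mem (inter_mem (hdom z) hNF) hG)
  obtain ⟨y, hzy, hyx⟩ := hcon x
  have hzx : ¬ (z = x ∨ R z x) := by
    rintro (rfl | h)
    · exact hR.irrefl _ hxz
    · exact hR.asymm _ _ hxz h
  have hzy : R z y := hzy.resolve_left (by rintro rfl; exact hzx hyx)
  have hyx : R y x := hyx.resolve_left (by rintro rfl; exact hzx (Or.inr hzy))
  obtain ⟨W, V, hW, hV, hyW, hxV, hWV⟩ := hR.exists_open hyx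
  obtain ⟨M, hM, hMc, hMF⟩ := hfree' y
  obtain ⟨W', hW's, hW', hyW'⟩ :=
    eventually_nhds_iff.1 (hR.swap.eventually_forall_notMem hX hM)
  exact ⟨V ∩ ({x | R x z} ∩ Nᶜ ∩ G), W ∩ W' ∩ {y | R z y},
    hV.inter (((hR.isOpen_left z).inter hNc.isOpen_compl).inter hGo), ⟨x, hxV, ⟨hxz, hxN⟩, hxG⟩,
    fun v hv => hv.2, (hW.inter hW').inter (hR.isOpen_right z), ⟨y, ⟨hyW, hyW'⟩, hzy⟩,
    fun w hw => hw.2, fun w hw v hv => hWV w hw.1.1 v hv.1, {g | R g y} ∩ Mᶜ,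
    inter_mem (hdom y) hMF, (hR.isOpen_left y).inter hMc.isOpen_compl,
    fun g hg w hw => hW's w hw.1.2 g hg.2 hg.1⟩

/-- Reversing a tournament on a clopen set `A` and letting the clopen set `S` point to its
complement, where `S` is `A` or `Aᶜ`, gives an open tournament. -/
theorem rearrange (hR : IsOpenTournament R) {A S : Set X} (hA : IsClopen A)
    (hS : S = A ∨ S = Aᶜ) : IsOpenTournament fun a b =>
      (a ∈ A ∧ b ∈ A ∧ R b a) ∨ (a ∈ Aᶜ ∧ b ∈ Aᶜ ∧ R a b) ∨ (a ∈ S ∧ b ∈ Sᶜ) where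
  asymm a b := by
    have := hR.asymm a b
    rcases hS with rfl | rfl <;> simp only [mem_compl_iff] <;> tauto
  total a b hab := by
    have := hR.total a b hab
    rcases hS with rfl | rfl <;> simp only [mem_compl_iff] <;> tauto
  isOpen := by
    have hSc : IsClopen S := by
      rcases hS with rfl | rfl
      exacts [hA, hA.compl]
    refine IsOpen.union ?_ (IsOpen.union ?_ ?_)
    · exact (hA.isOpen.preimage continuous_fst).inter
        ((hA.isOpen.preimage continuous_snd).inter hR.swap.isOpen)
    · exact (hA.compl.isOpen.preimage continuous_fst).inter
        ((hA.compl.isOpen.preimage continuous_snd).inter hR.isOpen)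
    · exact (hSc.isOpen.preimage continuous_fst).inter
        (hSc.compl.isOpen.preimage continuous_snd)

/-- A free ultrafilter can be made to dominate every point by rearranging the tournament. -/
theorem exists_dominated [RegularSpace X] (hR : IsOpenTournament R)
    (hX : HasOpenClusterPoints X) (F : Ultrafilter X) (hfree : ∀ x, ∃ N ∈ 𝓝 x, Nᶜ ∈ F) :
    ∃ R' : X → X → Prop, IsOpenTournament R' ∧ ∀ z, ∀ᶠ y in F, R' y z := by
  have hopen : ∀ {Q : X → X → Prop}, IsOpenTournament Q → IsOpen {x | ∀ᶠ y in F, Q x y} := by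
    intro Q hQ
    refine isOpen_iff_mem_nhds.2 fun x hx => ?_
    obtain ⟨N, hN, hNF⟩ := hfree x
    filter_upwards [hQ.eventually_forall_notMem hX hN] with x' hx'
    filter_upwards [hx, hNF] with y hy hyN using hx' y hyN hy
  set A : Set X := {x | ∀ᶠ y in F, R x y} with hAdef
  have hAc : Aᶜ = {x | ∀ᶠ y in F, R y x} := by
    ext x
    rw [mem_compl_iff, hAdef, mem_ofPred_eq, ← Ultrafilter.eventually_not, mem_ofPred_eq]
    obtain ⟨N, hN, hNF⟩ := hfree x
    refine eventually_congr ?_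
    filter_upwards [hNF] with y hy
    have hxy : x ≠ y := by
      rintro rfl
      exact hy (mem_of_mem_nhds hN)
    exact ⟨(hR.total x y hxy).resolve_left, hR.asymm y x⟩
  have hA : IsClopen A := ⟨⟨by rw [hAc]; exact hopen hR.swap⟩, hopen hR⟩
  obtain ⟨S, hS, hSF⟩ : ∃ S : Set X, (S = A ∨ S = Aᶜ) ∧ S ∈ F := by
    rcases F.mem_or_compl_mem A with h | h
    exacts [⟨A, Or.inl rfl, h⟩, ⟨Aᶜ, Or.inr rfl, h⟩]
  refine ⟨_, hR.rearrange hA hS, fun z => ?_⟩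
  by_cases hz : z ∈ S
  · by_cases hzA : z ∈ A
    · have hzR : ∀ᶠ y in F, R z y := hzA
      filter_upwards [hSF, hzR] with y hy hzy
      rcases hS with rfl | rfl
      · exact Or.inl ⟨hy, hzA, hzy⟩
      · exact absurd hzA hz
    · have hzR : ∀ᶠ y in F, R y z := by
        have : z ∈ Aᶜ := hzA
        rwa [hAc] at this
      filter_upwards [hSF, hzR] with y hy hzy
      rcases hS with rfl | rfl
      · exact absurd hz hzA
      · exact Or.inr (Or.inl ⟨hy, hzA, hzy⟩)
  · filter_upwards [hSF] with y hy using Or.inr (Or.inr ⟨hy, hz⟩)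

open Classical in
/-- The continuous weak selection choosing the head of each arrow. -/
theorem exists_weakSelection (hR : IsOpenTournament R) :
    ∃ φ : X → X → X, IsWeakSelection φ ∧ ContWeakSel φ ∧
      ∀ a b, SelArrow φ a b ↔ a = b ∨ R a b := by
  have hpos : ∀ {a b : X}, R a b → (if R a b then b else a) = b := fun h => if_pos h
  have hneg : ∀ {a b : X}, R b a → (if R a b then b else a) = a :=
    fun h => if_neg (hR.asymm _ _ h)
  refine ⟨fun a b => if R a b then b else a, ⟨fun a b => ?_, fun a b => ?_⟩, ?_, fun a b => ?_⟩
  · rcases eq_or_ne a b with rfl | hab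
    · rfl
    · rcases hR.total a b hab with h | h
      · simp only [hpos h, hneg h]
      · simp only [hpos h, hneg h]
  · dsimp only
    split_ifs
    exacts [Or.inr rfl, Or.inl rfl]
  · intro a b hab O hO hmem
    dsimp only at hmem ⊢
    rcases hR.total a b hab with h | h
    · obtain ⟨U, V, hU, hV, ha, hb, hUV⟩ := hR.exists_open h
      rw [hpos h] at hmem
      refine ⟨U, V ∩ O, hU, hV.inter hO, ha, ⟨hb, hmem⟩, fun a' ha' b' hb' _ => ?_⟩
      rw [hpos (hUV a' ha' b' hb'.1)]
      exact hb'.2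
    · obtain ⟨V, U, hV, hU, hb, ha, hVU⟩ := hR.exists_open h
      rw [hneg h] at hmem
      refine ⟨U ∩ O, V, hU.inter hO, hV, ⟨ha, hmem⟩, hb, fun a' ha' b' hb' _ => ?_⟩
      rw [hneg (hVU b' hb' a' ha'.1)]
      exact ha'.2
  · refine or_congr_right' fun hab => ?_
    by_cases h : R a b
    · simp [h, hab]
    · simp [h, hab]

end IsOpenTournament

theorem ContWeakSel.isOpenTournament [T2Space X] {φ : X → X → X} (hφ : IsWeakSelection φ)
    (hc : ContWeakSel φ) : IsOpenTournament fun a b => a ≠ b ∧ φ a b = b where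
  asymm a b := by
    rintro ⟨hab, h⟩ ⟨-, h'⟩
    rw [hφ.1, h] at h'
    exact hab h'.symm
  total a b hab := by
    rcases hφ.2 a b with h | h
    · exact Or.inr ⟨hab.symm, by rw [hφ.1, h]⟩
    · exact Or.inl ⟨hab, h⟩
  isOpen := by
    refine isOpen_prod_iff.2 fun a b hab => ?_
    obtain ⟨hab, h⟩ := hab
    obtain ⟨O, P, hO, hP, haO, hbP, hOP⟩ := t2_separation hab
    obtain ⟨U, V, hU, hV, ha, hb, hUV⟩ := hc a b hab P hP (by rwa [h])
    refine ⟨U ∩ O, V ∩ P, hU.inter hO, hV.inter hP, ⟨ha, haO⟩, ⟨hb, hbP⟩, ?_⟩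
    rintro ⟨a', b'⟩ ⟨ha', hb'⟩
    have hne : a' ≠ b' := by
      rintro rfl
      exact disjoint_left.1 hOP ha'.2 hb'.2
    refine ⟨hne, (hφ.2 a' b').resolve_left fun heq => ?_⟩
    have hmem := hUV a' ha'.1 b' hb'.1 hne
    rw [heq] at hmem
    exact disjoint_left.1 hOP ha'.2 hmem

end

/-- A pseudocompact Tychonoff king space with at least one continuous weak
selection is compact. -/
theorem pseudocompact_king_compact {X : Type*} [TopologicalSpace X]
    [T2Space X] [CompletelyRegularSpace X]
    (hsel : ∃ ψ : X → X → X, IsWeakSelection ψ ∧ ContWeakSel ψ)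
    (hking : IsKingSpace X)
    (hpseudo : ∀ f : X → ℝ, Continuous f → ∃ M : ℝ, ∀ x : X, |f x| ≤ M) :
    CompactSpace X := by
  have hX := hasOpenClusterPoints_of_pseudocompact hpseudo
  obtain ⟨ψ, hψ, hψc⟩ := hsel
  refine ⟨isCompact_iff_ultrafilter_le_nhds.2 fun F _ => ?_⟩
  by_contra! hcon
  have hfree : ∀ x, ∃ N ∈ 𝓝 x, Nᶜ ∈ F := by
    intro x
    obtain ⟨N, hN, hNF⟩ := Filter.not_le.1 (hcon x (mem_univ x))
    exact ⟨N, hN, Ultrafilter.compl_mem_iff_notMem.2 hNF⟩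
  obtain ⟨R, hR, hdom⟩ := (hψc.isOpenTournament hψ).exists_dominated hX F hfree
  obtain ⟨φ, hφ, hφc, harrow⟩ := hR.exists_weakSelection
  obtain ⟨z, hz⟩ := hking φ hφ hφc
  obtain ⟨x, hx⟩ := hR.exists_not_reachable hX (F := (F : Filter X)) hfree hdom z
  obtain ⟨y, hzy, hyx⟩ := hz x
  exact hx y ((harrow z y).1 hzy) ((harrow y x).1 hyx)
end

section
/- Let X be a Tychonoff space (completely regular Hausdorff) that admits at least one continuous weak selection and is a king space. If X is zero-dimensional (X has a base for its topology consisting of clopen sets), then X is compact. -/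
open Filter Topology Set

/-- A tournament on `X` whose arrow relation is open in `X × X`. -/
structure OpenTournament {X : Type*} [TopologicalSpace X] (r : X → X → Prop) : Prop where
  isOpen : IsOpen {q : X × X | r q.1 q.2}
  asymm : ∀ a b, r a b → ¬ r b a
  total : ∀ a b, a ≠ b → r a b ∨ r b a

/-- `c` is a cluster point of the sequence of sets `V`: each of its neighbourhoods meets
infinitely many of them. -/
def SetSeqCluster {X : Type*} [TopologicalSpace X] (V : ℕ → Set X) (c : X) : Prop :=
  ∀ O ∈ 𝓝 c, ∃ᶠ n in atTop, (V n ∩ O).Nonempty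

/-- Every sequence of nonempty open sets has a cluster point. -/
def FeeblyCompact (X : Type*) [TopologicalSpace X] : Prop :=
  ∀ V : ℕ → Set X, (∀ n, IsOpen (V n)) → (∀ n, (V n).Nonempty) → ∃ c, SetSeqCluster V c

/-- Every open tournament on `X` has a king. -/
def HasTournamentKings (X : Type*) [TopologicalSpace X] : Prop :=
  ∀ r : X → X → Prop, OpenTournament r →
    ∃ z, ∀ x, ∃ y, (z = y ∨ r z y) ∧ (y = x ∨ r y x)

section

variable {X : Type*} [TopologicalSpace X] {r : X → X → Prop}

namespace OpenTournament

theorem irrefl (hr : OpenTournament r) (a : X) : ¬ r a a := fun h => hr.asymm a a h h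

theorem ne (hr : OpenTournament r) {a b : X} (h : r a b) : a ≠ b := by
  rintro rfl
  exact hr.irrefl a h

theorem swap (hr : OpenTournament r) : OpenTournament (fun a b => r b a) where
  isOpen := hr.isOpen.preimage continuous_swap
  asymm a b h := hr.asymm b a h
  total a b h := (hr.total a b h).symm

theorem exists_rectangle (hr : OpenTournament r) {a b : X} (h : r a b) :
    ∃ U V : Set X, IsOpen U ∧ IsOpen V ∧ a ∈ U ∧ b ∈ V ∧ ∀ u ∈ U, ∀ v ∈ V, r u v := by
  obtain ⟨U, V, hU, hV, ha, hb, hUV⟩ := isOpen_prod_iff.1 hr.isOpen a b h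
  exact ⟨U, V, hU, hV, ha, hb, fun u hu v hv => hUV (mk_mem_prod hu hv)⟩

theorem isOpen_out (hr : OpenTournament r) (a : X) : IsOpen {y | r a y} :=
  hr.isOpen.preimage (Continuous.prodMk_right a)

theorem isOpen_in (hr : OpenTournament r) (a : X) : IsOpen {y | r y a} :=
  hr.swap.isOpen_out a

/-- Comparing first by a locally constant rank keeps a tournament open. -/
theorem lex (hr : OpenTournament r) {g : X → ℕ} (hg : Continuous g) :
    OpenTournament (fun a b => g b < g a ∨ (g a = g b ∧ r a b)) where
  isOpen := by
    have h₁ : IsOpen {q : X × X | g q.2 < g q.1} :=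
      isOpen_lt (hg.comp continuous_snd) (hg.comp continuous_fst)
    have h₂ : IsOpen {q : X × X | g q.1 = g q.2} :=
      (isOpen_discrete {q : ℕ × ℕ | q.1 = q.2}).preimage
        ((hg.comp continuous_fst).prodMk (hg.comp continuous_snd))
    exact h₁.union (h₂.inter hr.isOpen)
  asymm a b h h' := by
    have := hr.asymm a b
    rcases h with h | h <;> rcases h' with h' | h'
    · omega
    · omega
    · omega
    · exact this h.2 h'.2
  total a b h := by
    rcases lt_trichotomy (g a) (g b) with h' | h' | h'
    · exact Or.inr (Or.inl h')
    · exact (hr.total a b h).imp (fun t => Or.inr ⟨h', t⟩) (fun t => Or.inr ⟨h'.symm, t⟩)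
    · exact Or.inl (Or.inl h')

/-- A sequence of sets all of whose arrows point backwards has at most one cluster point. -/
theorem cluster_unique (hr : OpenTournament r) {W : ℕ → Set X}
    (hW : ∀ m n, m < n → ∀ x ∈ W n, ∀ y ∈ W m, r x y) {d e : X}
    (hd : SetSeqCluster W d) (he : SetSeqCluster W e) : d = e := by
  have key : ∀ d e, SetSeqCluster W d → SetSeqCluster W e → ¬ r d e := by
    intro d e hd he hde
    obtain ⟨D, E, hD, hE, hdD, heE, hDE⟩ := hr.exists_rectangle hde
    obtain ⟨n, x, hxn, hxD⟩ := (hd D (hD.mem_nhds hdD)).exists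
    obtain ⟨m, hm, y, hym, hyE⟩ := frequently_atTop.1 (he E (hE.mem_nhds heE)) (n + 1)
    exact hr.asymm x y (hDE x hxD y hyE) (hW n m (by omega) y hym x hxn)
  by_contra hne
  exact (hr.total d e hne).elim (key d e hd he) (key e d he hd)

theorem eventually_subset_of_cluster [RegularSpace X] (hr : OpenTournament r)
    (hX : FeeblyCompact X) {W : ℕ → Set X} (hWo : ∀ n, IsOpen (W n))
    (hW : ∀ m n, m < n → ∀ x ∈ W n, ∀ y ∈ W m, r x y) {e : X} (he : SetSeqCluster W e)
    {O : Set X} (hO : O ∈ 𝓝 e) : ∀ᶠ n in atTop, W n ⊆ O := by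
  obtain ⟨C, ⟨hC, hCc⟩, hCO⟩ := (closed_nhds_basis e).mem_iff.1 hO
  suffices h : ∀ᶠ n in atTop, W n ⊆ C from h.mono fun n hn => hn.trans hCO
  by_contra hcon
  obtain ⟨k, hk, hkW⟩ := extraction_of_frequently_atTop (not_eventually.1 hcon)
  obtain ⟨d, hd⟩ := hX (fun n => W (k n) ∩ Cᶜ) (fun n => (hWo _).inter hCc.isOpen_compl)
    (fun n => not_subset.1 (hkW n))
  have hde : d = e := by
    refine hr.cluster_unique hW (fun O hO => ?_) he
    refine hk.tendsto_atTop.frequently ((hd O hO).mono ?_)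
    rintro n ⟨x, hx, hxO⟩
    exact ⟨x, hx.1, hxO⟩
  subst hde
  obtain ⟨n, x, hx, hxC⟩ := (hd C hC).exists
  exact hx.2 hxC

theorem exists_convergent_of_frequently_out [RegularSpace X] (hr : OpenTournament r)
    (hX : FeeblyCompact X) {V : ℕ → Set X} (hV : ∀ n, IsOpen (V n)) {c : X}
    (hc : ∀ O ∈ 𝓝 c, ∃ᶠ n in atTop, ∃ y ∈ V n ∩ O, r c y) :
    ∃ k : ℕ → ℕ, StrictMono k ∧ ∃ W : ℕ → Set X, (∀ n, (W n).Nonempty ∧ W n ⊆ V (k n)) ∧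
      ∃ e, ∀ O ∈ 𝓝 e, ∀ᶠ n in atTop, W n ⊆ O := by
  have hrect : ∀ y, ∃ U Q : Set X, r c y → IsOpen U ∧ IsOpen Q ∧ c ∈ U ∧ y ∈ Q ∧
      ∀ u ∈ U, ∀ v ∈ Q, r u v := fun y => by
    by_cases h : r c y
    · obtain ⟨U, Q, h⟩ := hr.exists_rectangle h
      exact ⟨U, Q, fun _ => h⟩
    · exact ⟨∅, ∅, fun h' => absurd h' h⟩
  choose U Q hUQ using hrect
  obtain ⟨f, hf, hff⟩ := exists_seq_of_forall_finset_exists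
    (fun a : ℕ × X => a.2 ∈ V a.1 ∧ r c a.2) (fun a b => a.1 < b.1 ∧ b.2 ∈ U a.2) (by
      intro s hs
      have hO : (⋂ a ∈ s, U a.2) ∈ 𝓝 c := (biInter_finset_mem s).2 fun a ha =>
        (hUQ a.2 (hs a ha).2).1.mem_nhds (hUQ a.2 (hs a ha).2).2.2.1
      obtain ⟨n, hn, y, hy, hcy⟩ := frequently_atTop.1 (hc _ hO) (s.sup Prod.fst + 1)
      refine ⟨(n, y), ⟨hy.1, hcy⟩, fun a ha => ⟨?_, mem_iInter₂.1 hy.2 a ha⟩⟩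
      have := Finset.le_sup (f := Prod.fst) ha
      dsimp only
      omega)
  have hQ := fun n => hUQ (f n).2 (hf n).2
  let W : ℕ → Set X := fun n => (V (f n).1 ∩ Q (f n).2) ∩ ⋂ m ∈ Iio n, U (f m).2
  have hWo : ∀ n, IsOpen (W n) := fun n =>
    ((hV _).inter (hQ n).2.1).inter ((finite_Iio n).isOpen_biInter fun m _ => (hQ m).1)
  have hWn : ∀ n, (W n).Nonempty := fun n =>
    ⟨(f n).2, ⟨(hf n).1, (hQ n).2.2.2.1⟩, mem_iInter₂.2 fun m hm => (hff m n hm).2⟩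
  have hW : ∀ m n, m < n → ∀ x ∈ W n, ∀ y ∈ W m, r x y := fun m n hmn x hx y hy =>
    (hQ m).2.2.2.2 x (mem_iInter₂.1 hx.2 m hmn) y hy.1.2
  obtain ⟨e, he⟩ := hX W hWo hWn
  exact ⟨fun n => (f n).1, fun m n hmn => (hff m n hmn).1, W,
    fun n => ⟨hWn n, fun x hx => hx.1.1⟩, e,
    fun O hO => hr.eventually_subset_of_cluster hX hWo hW he hO⟩

/-- In a feebly compact space with an open tournament, every sequence of nonempty open sets can
be refined, along a subsequence, to a sequence of nonempty sets converging to a point. -/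
theorem exists_convergent [RegularSpace X] (hr : OpenTournament r) (hX : FeeblyCompact X)
    {V : ℕ → Set X} (hV : ∀ n, IsOpen (V n)) (hVn : ∀ n, (V n).Nonempty) :
    ∃ k : ℕ → ℕ, StrictMono k ∧ ∃ W : ℕ → Set X, (∀ n, (W n).Nonempty ∧ W n ⊆ V (k n)) ∧
      ∃ e, ∀ O ∈ 𝓝 e, ∀ᶠ n in atTop, W n ⊆ O := by
  obtain ⟨c, hc⟩ := hX V hV hVn
  by_cases hiso : {c} ∈ 𝓝 c
  · obtain ⟨k, hk, hkV⟩ := extraction_of_frequently_atTop (hc _ hiso)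
    refine ⟨k, hk, fun _ => {c}, fun n => ⟨singleton_nonempty c, ?_⟩, c, fun O hO =>
      Eventually.of_forall fun n => singleton_subset_iff.2 (mem_of_mem_nhds hO)⟩
    obtain ⟨x, hx, rfl⟩ := hkV n
    exact singleton_subset_iff.2 hx
  by_cases h₁ : ∀ O ∈ 𝓝 c, ∃ᶠ n in atTop, ∃ y ∈ V n ∩ O, r c y
  · exact hr.exists_convergent_of_frequently_out hX hV h₁
  by_cases h₂ : ∀ O ∈ 𝓝 c, ∃ᶠ n in atTop, ∃ y ∈ V n ∩ O, r y c
  · exact hr.swap.exists_convergent_of_frequently_out hX hV h₂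
  exfalso
  push Not at h₁ h₂
  obtain ⟨O₁, hO₁, h₁⟩ := h₁
  obtain ⟨O₂, hO₂, h₂⟩ := h₂
  obtain ⟨O, hO, hOo, hcO⟩ := mem_nhds_iff.1 (inter_mem hO₁ hO₂)
  obtain ⟨n, ⟨y, hyV, hyO⟩, hn₁, hn₂⟩ :=
    ((hc O (hOo.mem_nhds hcO)).and_eventually (h₁.and h₂)).exists
  have hall : V n ∩ O ⊆ {c} := fun y hy => by
    by_contra hne
    exact (hr.total c y (Ne.symm hne)).elim (hn₁ y ⟨hy.1, (hO hy.2).1⟩)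
      (hn₂ y ⟨hy.1, (hO hy.2).2⟩)
  obtain rfl : y = c := hall ⟨hyV, hyO⟩
  exact hiso (mem_of_superset (((hV n).inter hOo).mem_nhds ⟨hyV, hyO⟩) hall)

/-- If each point of a clopen set `K` is dominated locally uniformly by a filter living off `K`,
then `K` is dominated uniformly by the filter. -/
theorem exists_mem_forall_arrow [RegularSpace X] (hr : OpenTournament r) (hX : FeeblyCompact X)
    {K : Set X} (hK : IsClopen K) {F : Filter X} (hKF : Kᶜ ∈ F)
    (hF : ∀ y ∈ K, ∃ S Y : Set X, IsOpen S ∧ S ∈ F ∧ IsOpen Y ∧ y ∈ Y ∧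
      ∀ s ∈ S, ∀ y' ∈ Y, r s y') :
    ∃ S ∈ F, ∀ x ∈ S, ∀ y ∈ K, r x y := by
  by_contra hcon
  have hbad : ∀ S ∈ F, ∃ x ∈ S ∩ Kᶜ, ∃ y ∈ K, r y x := by
    intro S hS
    by_contra! h
    refine hcon ⟨S ∩ Kᶜ, inter_mem hS hKF, fun x hx y hy => ?_⟩
    have hxy : x ≠ y := by
      rintro rfl
      exact hx.2 hy
    exact (hr.total x y hxy).resolve_right (h x hx y hy)
  choose! S Y hS using hF
  obtain ⟨f, hf, hff⟩ := exists_seq_of_forall_finset_exists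
    (fun a : X × X => a.1 ∈ Kᶜ ∧ a.2 ∈ K ∧ r a.2 a.1) (fun a b => b.1 ∈ S a.2) (by
      intro s hs
      obtain ⟨x, hx, y, hy, hyx⟩ := hbad (⋂ a ∈ s, S a.2)
        ((biInter_finset_mem s).2 fun a ha => (hS a.2 (hs a ha).2.1).2.1)
      exact ⟨(x, y), ⟨hx.2, hy, hyx⟩, fun a ha => mem_iInter₂.1 hx.1 a ha⟩)
  have hS' := fun n => hS (f n).2 (hf n).2.1
  choose P Q hPQ using fun n => hr.exists_rectangle (hf n).2.2
  let V : ℕ → Set X := fun n => (P n ∩ K) ∩ Y (f n).2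
  let T : ℕ → Set X := fun n => (Q n ∩ Kᶜ) ∩ ⋂ m ∈ Iio n, S (f m).2
  have hV : ∀ n, IsOpen (V n) := fun n => ((hPQ n).1.inter hK.isOpen).inter (hS' n).2.2.1
  have hVn : ∀ n, (V n).Nonempty := fun n =>
    ⟨(f n).2, ⟨(hPQ n).2.2.1, (hf n).2.1⟩, (hS' n).2.2.2.1⟩
  have hT : ∀ n, IsOpen (T n) := fun n => ((hPQ n).2.1.inter hK.isClosed.isOpen_compl).inter
    ((finite_Iio n).isOpen_biInter fun m _ => (hS' m).1)
  have hTn : ∀ n, (T n).Nonempty := fun n =>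
    ⟨(f n).1, ⟨(hPQ n).2.2.2.1, (hf n).1⟩, mem_iInter₂.2 fun m hm => hff m n hm⟩
  have hVT : ∀ n, ∀ y ∈ V n, ∀ x ∈ T n, r y x := fun n y hy x hx =>
    (hPQ n).2.2.2.2 y hy.1.1 x hx.1.1
  have hTV : ∀ m n, m < n → ∀ x ∈ T n, ∀ y ∈ V m, r x y := fun m n hmn x hx y hy =>
    (hS' m).2.2.2.2 x (mem_iInter₂.1 hx.2 m hmn) y hy.2
  obtain ⟨k, hk, W, hW, c, hc⟩ := hr.exists_convergent hX hV hVn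
  obtain ⟨d, hd⟩ := hX (fun n => T (k n)) (fun n => hT _) (fun n => hTn _)
  have hcK : c ∈ K := by
    by_contra hcK
    obtain ⟨n, hn⟩ := (hc _ (hK.isClosed.isOpen_compl.mem_nhds hcK)).exists
    obtain ⟨x, hx⟩ := (hW n).1
    exact hn hx ((hW n).2 hx).1.2
  have hdK : d ∉ K := by
    intro hdK
    obtain ⟨n, x, hx, hxK⟩ := (hd _ (hK.isOpen.mem_nhds hdK)).exists
    exact hx.1.2 hxK
  have hcd : c ≠ d := by
    rintro rfl
    exact hdK hcK
  rcases hr.total c d hcd with h | h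
  · obtain ⟨C, D, hC, hD, hcC, hdD, hCD⟩ := hr.exists_rectangle h
    obtain ⟨m, hm⟩ := (hc C (hC.mem_nhds hcC)).exists
    obtain ⟨y, hy⟩ := (hW m).1
    obtain ⟨n, hn, x, hx, hxD⟩ := frequently_atTop.1 (hd D (hD.mem_nhds hdD)) (m + 1)
    exact hr.asymm y x (hCD y (hm hy) x hxD)
      (hTV (k m) (k n) (hk (by omega)) x hx y ((hW m).2 hy))
  · obtain ⟨D, C, hD, hC, hdD, hcC, hDC⟩ := hr.exists_rectangle h
    obtain ⟨n, ⟨x, hx, hxD⟩, hn⟩ :=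
      ((hd D (hD.mem_nhds hdD)).and_eventually (hc C (hC.mem_nhds hcC))).exists
    obtain ⟨y, hy⟩ := (hW n).1
    exact hr.asymm x y (hDC x hxD y (hn hy)) (hVT (k n) y ((hW n).2 hy) x hx)

theorem out_union_isClopen (hr : OpenTournament r) {z : X} {U : Set X} (hU : IsClopen U)
    (hz : z ∈ U) : IsClopen ({y | r z y} ∪ U) := by
  refine ⟨⟨?_⟩, (hr.isOpen_out z).union hU.isOpen⟩
  convert (hr.isOpen_in z).inter hU.isClosed.isOpen_compl using 1
  ext y
  simp only [mem_compl_iff, mem_union, mem_ofPred_eq, not_or, mem_inter_iff, and_congr_left_iff]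
  intro hy
  have hzy : z ≠ y := by
    rintro rfl
    exact hy hz
  exact ⟨(hr.total z y hzy).resolve_left, hr.asymm y z⟩

/-- If an ultrafilter `p` dominates `a` without converging to it, then some open member of `p`
dominates a neighbourhood of `a`. -/
theorem exists_rectangle_of_ultrafilter [RegularSpace X] (hr : OpenTournament r)
    (hX : FeeblyCompact X) {p : Ultrafilter X} {a : X} {U : Set X} (hU : IsClopen U)
    (haU : a ∈ U) (hUp : U ∉ p) (ha : {y | r y a} ∈ p) :
    ∃ S Y : Set X, IsOpen S ∧ S ∈ p ∧ IsOpen Y ∧ a ∈ Y ∧ ∀ s ∈ S, ∀ y ∈ Y, r s y := by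
  have hL := hr.out_union_isClopen hU haU
  set K : Set X := ({y | r a y} ∪ U)ᶜ with hKdef
  have hKa : ∀ y ∈ K, r y a := by
    intro y hy
    rw [hKdef, mem_compl_iff, mem_union, not_or] at hy
    refine (hr.total y a ?_).resolve_right hy.1
    rintro rfl
    exact hy.2 haU
  have hKp : K ∈ p := by
    filter_upwards [ha, Ultrafilter.compl_mem_iff_notMem.2 hUp] with y hy hyU hmem
    exact hmem.elim (hr.asymm y a hy) hyU
  obtain ⟨Y, hY, hYK⟩ := hr.swap.exists_mem_forall_arrow hX hL.compl (F := 𝓝 a)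
    (by
      rw [compl_compl]
      exact hL.isOpen.mem_nhds (Or.inr haU))
    (fun y hy => by
      obtain ⟨A, B, hA, hB, hyA, haB, hAB⟩ := hr.exists_rectangle (hKa y hy)
      exact ⟨B, A, hB, hB.mem_nhds haB, hA, hyA, fun b hb a ha => hAB a ha b hb⟩)
  obtain ⟨Z, hZY, hZ, haZ⟩ := mem_nhds_iff.1 hY
  exact ⟨K, Z, hL.compl.isOpen, hKp, hZ, haZ, fun s hs y hy => hYK y (hZY hy) s hs⟩

end OpenTournament

theorem feeblyCompact_of_hasTournamentKings (hking : HasTournamentKings X)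
    (hr : OpenTournament r)
    (hclopen : ∀ x : X, ∀ O ∈ 𝓝 x, ∃ U, IsClopen U ∧ x ∈ U ∧ U ⊆ O) : FeeblyCompact X := by
  intro V hV hVn
  by_contra! hcon
  choose x hx using hVn
  choose C hC hxC hCV using fun n => hclopen (x n) (V n) ((hV n).mem_nhds (hx n))
  have hfin : LocallyFinite C := by
    intro c
    have h := hcon c
    unfold SetSeqCluster at h
    push Not at h
    obtain ⟨O, hO, hfO⟩ := h
    obtain ⟨N, hN⟩ := eventually_atTop.1 hfO
    refine ⟨O, hO, (finite_lt_nat N).subset ?_⟩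
    rintro n ⟨y, hyC, hyO⟩
    by_contra hn
    exact (hN n (not_lt.1 hn)).subset ⟨hCV n hyC, hyO⟩
  have hbdd : ∀ y, ∃ n, ∀ m, n ≤ m → y ∉ C m := fun y => by
    obtain ⟨N, hN⟩ := (hfin.point_finite y).bddAbove
    refine ⟨N + 1, fun m hm hy => ?_⟩
    have := hN hy
    omega
  classical
  let g : X → ℕ := fun y => Nat.find (hbdd y)
  have hlt : ∀ n y, n < g y ↔ y ∈ ⋃ m : {m // n ≤ m}, C m := by
    intro n y
    simp only [g, Nat.lt_find_iff, mem_iUnion, Subtype.exists, not_forall, not_not, exists_prop]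
    refine ⟨fun h => h n le_rfl, ?_⟩
    rintro ⟨m, hm, hy⟩ k hk
    exact ⟨m, hk.trans hm, hy⟩
  have hclo : ∀ n, IsClopen {y | n < g y} := by
    intro n
    simp only [hlt, ofPred_mem_eq]
    exact ⟨(hfin.comp_injective Subtype.val_injective).isClosed_iUnion fun m => (hC m).isClosed,
      isOpen_iUnion fun m => (hC m).isOpen⟩
  have hg : Continuous g := by
    rw [continuous_discrete_rng]
    intro n
    rcases n with _ | n
    · convert (hclo 0).compl.isOpen using 1
      ext y
      simp
    · convert (hclo n).isOpen.inter (hclo (n + 1)).compl.isOpen using 1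
      ext y
      simp only [mem_preimage, mem_singleton_iff, mem_inter_iff, mem_ofPred_eq, mem_compl_iff]
      omega
  obtain ⟨z, hz⟩ := hking _ (hr.lex hg)
  have hxg : g z < g (x (g z)) := (hlt _ _).2 (mem_iUnion.2 ⟨⟨g z, le_rfl⟩, hxC _⟩)
  obtain ⟨y, hzy, hyx⟩ := hz (x (g z))
  have h₁ : g y ≤ g z := by
    rcases hzy with rfl | h | h
    · exact le_rfl
    · exact h.le
    · exact h.1.ge
  have h₂ : g (x (g z)) ≤ g y := by
    rcases hyx with h | h | h
    · rw [h]
    · exact h.le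
    · exact h.1.ge
  omega

/-- A free ultrafilter cannot dominate almost every point of a space whose open tournaments
have kings. -/
theorem setOf_dominated_notMem [RegularSpace X] (hking : HasTournamentKings X)
    (hX : FeeblyCompact X) (hr : OpenTournament r) {p : Ultrafilter X}
    (hp : ∀ x : X, ∃ U, IsClopen U ∧ x ∈ U ∧ U ∉ p)
    (hBc : IsClopen {x | {y | r y x} ∈ p}) : {x | {y | r y x} ∈ p} ∉ p := by
  intro hBp
  set B : Set X := {x | {y | r y x} ∈ p} with hB
  classical
  have hg : Continuous (fun x => if x ∈ B then 1 else 0 : X → ℕ) :=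
    Continuous.if (fun a ha => by simp [hBc.frontier_eq] at ha) continuous_const continuous_const
  obtain ⟨z, hz⟩ := hking _ (hr.lex hg)
  have hcases : ∀ a b, b ∈ B → (a = b ∨ (if b ∈ B then 1 else 0) < (if a ∈ B then 1 else 0) ∨
      ((if a ∈ B then 1 else 0) = (if b ∈ B then 1 else 0) ∧ r a b)) →
      a ∈ B ∧ (a = b ∨ r a b) := by
    intro a b hb h
    by_cases ha : a ∈ B <;> simp_all
  have hzB : z ∈ B := by
    obtain ⟨x, hx⟩ := p.nonempty_of_mem hBp
    obtain ⟨y, hzy, hyx⟩ := hz x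
    exact (hcases z y (hcases y x hx hyx).1 hzy).1
  obtain ⟨U, hU, hzU, hUp⟩ := hp z
  have hL := hr.out_union_isClopen hU hzU
  obtain ⟨S, hSp, hS⟩ := hr.exists_mem_forall_arrow hX (hBc.inter hL) (F := p)
    (by
      filter_upwards [show {y | r y z} ∈ p from hzB,
        Ultrafilter.compl_mem_iff_notMem.2 hUp] with y hy hyU hmem
      exact hmem.2.elim (hr.asymm y z hy) hyU)
    (fun y hy => by
      obtain ⟨U, hU, hyU, hUp⟩ := hp y
      exact hr.exists_rectangle_of_ultrafilter hX hU hyU hUp hy.1)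
  obtain ⟨x, hxS, hxB⟩ := p.nonempty_of_mem (inter_mem hSp hBp)
  obtain ⟨y, hzy, hyx⟩ := hz x
  obtain ⟨hyB, hyx⟩ := hcases y x hxB hyx
  obtain ⟨-, hzy⟩ := hcases z y hyB hzy
  have hyL : y ∈ {y | r z y} ∪ U := by
    rcases hzy with rfl | h
    · exact Or.inr hzU
    · exact Or.inl h
  have hxy := hS x hxS y ⟨hyB, hyL⟩
  rcases hyx with rfl | h
  · exact hr.irrefl y hxy
  · exact hr.asymm x y hxy h

theorem isOpen_setOf_dominated [RegularSpace X] (hX : FeeblyCompact X)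
    (hr : OpenTournament r) {p : Ultrafilter X}
    (hp : ∀ x : X, ∃ U, IsClopen U ∧ x ∈ U ∧ U ∉ p) : IsOpen {x | {y | r y x} ∈ p} := by
  refine isOpen_iff_mem_nhds.2 fun a ha => ?_
  obtain ⟨U, hU, haU, hUp⟩ := hp a
  obtain ⟨S, Y, -, hSp, hY, haY, hSY⟩ := hr.exists_rectangle_of_ultrafilter hX hU haU hUp ha
  filter_upwards [hY.mem_nhds haY] with y hy
  exact mem_of_superset hSp fun s hs => hSY s hs y hy

theorem compactSpace_of_hasTournamentKings [RegularSpace X] (hking : HasTournamentKings X)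
    (hr : OpenTournament r)
    (hclopen : ∀ x : X, ∀ O ∈ 𝓝 x, ∃ U, IsClopen U ∧ x ∈ U ∧ U ⊆ O) : CompactSpace X := by
  have hX := feeblyCompact_of_hasTournamentKings hking hr hclopen
  rw [← isCompact_univ_iff, isCompact_iff_ultrafilter_le_nhds]
  intro p _
  by_contra! hcon
  have hp : ∀ x : X, ∃ U, IsClopen U ∧ x ∈ U ∧ U ∉ p := fun x => by
    obtain ⟨O, hO, hOp⟩ := not_subset.1 (hcon x (mem_univ x))
    obtain ⟨U, hU, hxU, hUO⟩ := hclopen x O hO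
    exact ⟨U, hU, hxU, fun h => hOp (mem_of_superset h hUO)⟩
  have hcompl : {x | {y | r y x} ∈ p}ᶜ = {x | {y | r x y} ∈ p} := by
    ext x
    obtain ⟨U, hU, hxU, hUp⟩ := hp x
    rw [mem_compl_iff, mem_ofPred_eq, mem_ofPred_eq, ← Ultrafilter.compl_mem_iff_notMem]
    refine ⟨fun h => ?_, fun h => ?_⟩
    · filter_upwards [h, Ultrafilter.compl_mem_iff_notMem.2 hUp] with y hy hyU
      refine (hr.total x y ?_).resolve_right hy
      rintro rfl
      exact hyU hxU
    · filter_upwards [h] with y hy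
      exact hr.asymm x y hy
  have h₁ := isOpen_setOf_dominated hX hr hp
  have h₂ := isOpen_setOf_dominated hX hr.swap hp
  have hclop : IsClopen {x | {y | r y x} ∈ p} := ⟨⟨hcompl ▸ h₂⟩, h₁⟩
  have h₃ := setOf_dominated_notMem hking hX hr hp hclop
  refine setOf_dominated_notMem hking hX hr.swap hp (hcompl ▸ hclop.compl) ?_
  rw [← Ultrafilter.compl_mem_iff_notMem, hcompl] at h₃
  exact h₃

theorem IsKingSpace.hasTournamentKings (h : IsKingSpace X) : HasTournamentKings X := by
  intro r hr
  classical
  have hsymm : ∀ a b : X, (if r a b then b else a) = if r b a then a else b := by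
    intro a b
    by_cases hab : a = b
    · subst hab
      simp
    · rcases hr.total a b hab with h | h
      · simp [h, hr.asymm a b h]
      · simp [h, hr.asymm b a h]
  obtain ⟨z, hz⟩ := h (fun a b => if r a b then b else a)
    ⟨hsymm, fun a b => by by_cases h : r a b <;> simp [h]⟩ (by
      intro a b hab W hW hmem
      rcases hr.total a b hab with h | h
      · obtain ⟨U, V, hU, hV, haU, hbV, hUV⟩ := hr.exists_rectangle h
        simp only [h, if_true] at hmem
        refine ⟨U, V ∩ W, hU, hV.inter hW, haU, ⟨hbV, hmem⟩, fun a' ha b' hb _ => ?_⟩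
        simpa only [hUV a' ha b' hb.1, if_true] using hb.2
      · obtain ⟨V, U, hV, hU, hbV, haU, hVU⟩ := hr.exists_rectangle h
        simp only [hr.asymm b a h, if_false] at hmem
        refine ⟨U ∩ W, V, hU.inter hW, hV, ⟨haU, hmem⟩, hbV, fun a' ha b' hb _ => ?_⟩
        simpa only [hr.asymm b' a' (hVU b' hb a' ha.1), if_false] using ha.2)
  have harrow : ∀ a b, SelArrow (fun a b => if r a b then b else a) a b → a = b ∨ r a b := by
    rintro a b (h | ⟨hne, h⟩)
    · exact Or.inl h
    · by_cases hab : r a b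
      · exact Or.inr hab
      · simp only [hab, if_false] at h
        exact Or.inl h
  refine ⟨z, fun x => ?_⟩
  obtain ⟨y, hzy, hyx⟩ := hz x
  exact ⟨y, harrow z y hzy, harrow y x hyx⟩

theorem ContWeakSel.openTournament [T2Space X] {ψ : X → X → X} (hψ : IsWeakSelection ψ)
    (hc : ContWeakSel ψ) : OpenTournament (fun a b => a ≠ b ∧ ψ a b = b) where
  isOpen := by
    refine isOpen_prod_iff.2 ?_
    rintro a b ⟨hab, hψab⟩
    dsimp only at hab hψab
    obtain ⟨A, B, hA, hB, haA, hbB, hAB⟩ := t2_separation hab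
    obtain ⟨U, V, hU, hV, haU, hbV, hUV⟩ := hc a b hab B hB (hψab.symm ▸ hbB)
    refine ⟨U ∩ A, V ∩ B, hU.inter hA, hV.inter hB, ⟨haU, haA⟩, ⟨hbV, hbB⟩, ?_⟩
    rintro ⟨a', b'⟩ ⟨ha, hb⟩
    have hne : a' ≠ b' := hAB.ne_of_mem ha.2 hb.2
    have hmem := hUV a' ha.1 b' hb.1 hne
    refine ⟨hne, (hψ.2 a' b').resolve_left fun h => ?_⟩
    exact hAB.ne_of_mem ha.2 hmem h.symm
  asymm := by
    rintro a b ⟨hab, h⟩ ⟨-, h'⟩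
    exact hab (h'.symm.trans ((hψ.1 b a).trans h))
  total a b hab := by
    rcases hψ.2 a b with h | h
    · exact Or.inr ⟨hab.symm, (hψ.1 b a).trans h⟩
    · exact Or.inl ⟨hab, h⟩

end

/-- A zero-dimensional Tychonoff king space with at least one continuous weak
selection is compact. -/
theorem zero_dimensional_king_compact {X : Type*} [TopologicalSpace X]
    [T2Space X] [CompletelyRegularSpace X]
    (hsel : ∃ ψ : X → X → X, IsWeakSelection ψ ∧ ContWeakSel ψ)
    (hking : IsKingSpace X)
    (hzd : ∃ B : Set (Set X), TopologicalSpace.IsTopologicalBasis B ∧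
      ∀ V ∈ B, IsClopen V) :
    CompactSpace X := by
  obtain ⟨ψ, hψ, hc⟩ := hsel
  obtain ⟨B, hB, hBc⟩ := hzd
  refine compactSpace_of_hasTournamentKings hking.hasTournamentKings (hc.openTournament hψ)
    fun x O hO => ?_
  obtain ⟨U, hU, hxU, hUO⟩ := hB.mem_nhds_iff.1 hO
  exact ⟨U, hBc U hU, hxU, hUO⟩
end

section
/- Let X be a Tychonoff space (completely regular Hausdorff) that admits at least one continuous weak selection and is a king space. If X is locally connected, then X is compact. -/
open Set Topology

section LinearOrder

variable {Y : Type*} [TopologicalSpace Y] [LinearOrder Y] [PreconnectedSpace Y]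

/-- In a connected, locally connected linearly ordered space with open rays, a neighbourhood of `p`
contains `[p, c)` for some `c > p`, unless `p` is the largest point. -/
theorem isTop_or_exists_Ico_subset [LocallyConnectedSpace Y]
    (hIio : ∀ a : Y, IsOpen (Iio a)) (hIoi : ∀ a : Y, IsOpen (Ioi a))
    {p : Y} {U : Set Y} (hU : U ∈ 𝓝 p) : IsTop p ∨ ∃ c, p < c ∧ Ico p c ⊆ U := by
  obtain ⟨V, hVU, hVo, hpV, hVc⟩ :=
    locallyConnectedSpace_iff_subsets_isOpen_isConnected.1 ‹_› p U hU
  by_cases h : ∃ c ∈ V, p < c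
  · obtain ⟨c, hcV, hpc⟩ := h
    refine Or.inr ⟨c, hpc, fun x hx => hVU ?_⟩
    by_contra hxV
    obtain ⟨y, -, hy⟩ := hVc.2 (Iio x) (Ioi x) (hIio x) (hIoi x)
      (fun y hy => lt_or_gt_of_ne fun e => hxV (e ▸ hy))
      ⟨p, hpV, lt_of_le_of_ne hx.1 fun e => hxV (e ▸ hpV)⟩ ⟨c, hcV, hx.2⟩
    exact lt_asymm hy.1 hy.2
  · push Not at h
    refine Or.inl fun x => ?_
    by_contra! hx
    obtain ⟨y, hy, hy'⟩ := nonempty_inter ((hIio p).union hVo) (hIoi p)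
      (by
        ext y
        rcases lt_trichotomy y p with hy | rfl | hy <;> simp [*])
      ⟨p, Or.inr hpV⟩ ⟨x, hx⟩
    exact hy.elim (fun hy => lt_asymm hy hy') fun hy => (h y hy).not_gt hy'

/-- A connected, locally connected linearly ordered space with open rays and both endpoints is
compact. -/
theorem compactSpace_of_isOpen_rays [LocallyConnectedSpace Y]
    (hIio : ∀ a : Y, IsOpen (Iio a)) (hIoi : ∀ a : Y, IsOpen (Ioi a))
    {m M : Y} (hm : IsBot m) (hM : IsTop M) : CompactSpace Y := by
  have right {p : Y} {U : Set Y} (hU : U ∈ 𝓝 p) := isTop_or_exists_Ico_subset hIio hIoi hU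
  have : PreconnectedSpace Yᵒᵈ := ‹PreconnectedSpace Y›
  have : LocallyConnectedSpace Yᵒᵈ := ‹LocallyConnectedSpace Y›
  have left {p : Y} {U : Set Y} (hU : U ∈ 𝓝 p) : IsBot p ∨ ∃ c, c < p ∧ Ioc c p ⊆ U := by
    rcases isTop_or_exists_Ico_subset (Y := Yᵒᵈ) hIoi hIio (p := p) (U := U) hU with h | ⟨c, hc, h⟩
    · exact Or.inl h
    · exact Or.inr ⟨c, hc, fun x hx => h ⟨hx.2, hx.1⟩⟩
  refine ⟨isCompact_iff_ultrafilter_le_nhds.2 fun F _ => ?_⟩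
  let A : Set Y := {x | Ici x ∈ F}
  have hAc {x : Y} : x ∉ A ↔ Iio x ∈ F := by
    rw [← compl_Ici, Ultrafilter.compl_mem_iff_notMem]; rfl
  have hmA : m ∈ A := Filter.mem_of_superset Filter.univ_mem fun x _ => hm x
  have hlower {x y : Y} (hxy : x ≤ y) (hy : y ∈ A) : x ∈ A :=
    Filter.mem_of_superset hy (Ici_subset_Ici.2 hxy)
  by_cases hmax : ∃ p ∈ A, ∀ x ∈ A, x ≤ p
  · obtain ⟨p, hp, hpmax⟩ := hmax
    refine ⟨p, mem_univ p, fun U hU => ?_⟩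
    rcases right hU with htop | ⟨c, hpc, hcU⟩
    · exact Filter.mem_of_superset hp
        fun x hx => (le_antisymm hx (htop x)) ▸ mem_of_mem_nhds hU
    · have hc : Iio c ∈ F := hAc.1 fun hc => (hpmax c hc).not_gt hpc
      exact Filter.mem_of_superset (Filter.inter_mem hp hc) hcU
  by_cases hmin : ∃ p ∉ A, ∀ x ∉ A, p ≤ x
  · obtain ⟨p, hp, hpmin⟩ := hmin
    refine ⟨p, mem_univ p, fun U hU => ?_⟩
    rcases left hU with hbot | ⟨c, hcp, hcU⟩
    · exact absurd (hlower (hbot m) hmA) hp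
    · have hc : Ici c ∈ F := by
        by_contra hc
        exact (hpmin c hc).not_gt hcp
      have hc' : Ici c ∩ Iio p ∈ F := Filter.inter_mem hc (hAc.1 hp)
      by_cases hgap : ∃ d, c < d ∧ d < p
      · obtain ⟨d, hcd, hdp⟩ := hgap
        have hd : Ici d ∈ F := by
          by_contra hd
          exact (hpmin d hd).not_gt hdp
        exact Filter.mem_of_superset (Filter.inter_mem hd (hAc.1 hp))
          fun x hx => hcU ⟨hcd.trans_le hx.1, hx.2.le⟩
      · push Not at hgap
        obtain ⟨y, hy, hy'⟩ := nonempty_inter (hIio p) (hIoi c)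
          (eq_univ_of_forall fun y => (lt_or_ge y p).imp id fun hy => hcp.trans_le hy)
          ⟨c, hcp⟩ ⟨p, hcp⟩
        exact absurd hy (hgap y hy').not_gt
  push Not at hmax hmin
  have hA : IsOpen A := by
    rw [show A = ⋃ a ∈ A, Iio a from ?_]
    · exact isOpen_biUnion fun a _ => hIio a
    · ext x
      simp only [mem_iUnion, mem_Iio, exists_prop]
      exact ⟨fun hx => hmax x hx, fun ⟨a, ha, hxa⟩ => hlower hxa.le ha⟩
  have hA' : IsOpen Aᶜ := by
    rw [show Aᶜ = ⋃ a ∈ Aᶜ, Ioi a from ?_]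
    · exact isOpen_biUnion fun a _ => hIoi a
    · ext x
      simp only [mem_iUnion, mem_Ioi, exists_prop]
      exact ⟨fun hx => hmin x hx, fun ⟨a, ha, hax⟩ hx => ha (hlower hax.le hx)⟩
  have hAuniv := IsClopen.eq_univ ⟨⟨hA'⟩, hA⟩ ⟨m, hmA⟩
  obtain ⟨x, -, hx⟩ := hmax M (hAuniv ▸ mem_univ M)
  exact absurd (hM x) hx.not_ge

end LinearOrder

section Selection

variable {X : Type*} {φ : X → X → X}

theorem IsWeakSelection.eq_right_of_ne (h : IsWeakSelection φ) {a b : X} (hab : φ a b ≠ a) :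
    φ a b = b :=
  (h.2 a b).resolve_left hab

theorem IsWeakSelection.selArrow_iff (h : IsWeakSelection φ) {a b : X} :
    SelArrow φ a b ↔ φ a b = b := by
  by_cases hab : a = b
  · subst hab
    simpa [SelArrow] using (h.2 a a).elim id id
  · simp [SelArrow, hab]

/-- A weak selection on a Hausdorff space is continuous iff the selected point does not change its
side when the two points are moved slightly. -/
theorem IsWeakSelection.contWeakSel_iff [TopologicalSpace X] [T2Space X] (h : IsWeakSelection φ) :
    ContWeakSel φ ↔ ∀ a b : X, a ≠ b → φ a b = a → ∃ U V : Set X, IsOpen U ∧ IsOpen V ∧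
      a ∈ U ∧ b ∈ V ∧ ∀ a' ∈ U, ∀ b' ∈ V, a' ≠ b' ∧ φ a' b' = a' := by
  refine ⟨fun hc a b hab hφ => ?_, fun hl a b hab W hW hφ => ?_⟩
  · obtain ⟨A, B, hA, hB, haA, hbB, hAB⟩ := t2_separation hab
    obtain ⟨U, V, hU, hV, haU, hbV, hUV⟩ := hc a b hab A hA (by rwa [hφ])
    refine ⟨U ∩ A, V ∩ B, hU.inter hA, hV.inter hB, ⟨haU, haA⟩, ⟨hbV, hbB⟩,
      fun a' ha' b' hb' => ?_⟩
    have hne : a' ≠ b' := fun e => disjoint_left.1 hAB ha'.2 (e ▸ hb'.2)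
    refine ⟨hne, (h.2 a' b').resolve_right fun e => ?_⟩
    exact disjoint_left.1 hAB (e ▸ hUV a' ha'.1 b' hb'.1 hne) hb'.2
  · rcases h.2 a b with e | e
    · obtain ⟨U, V, hU, hV, haU, hbV, hUV⟩ := hl a b hab e
      refine ⟨U ∩ W, V, hU.inter hW, hV, ⟨haU, e ▸ hφ⟩, hbV, fun a' ha' b' hb' _ => ?_⟩
      rw [(hUV a' ha'.1 b' hb').2]
      exact ha'.2
    · obtain ⟨U, V, hU, hV, hbU, haV, hUV⟩ := hl b a hab.symm (h.1 b a ▸ e)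
      refine ⟨V, U ∩ W, hV, hU.inter hW, haV, ⟨hbU, e ▸ hφ⟩, fun a' ha' b' hb' _ => ?_⟩
      rw [h.1, (hUV b' hb'.1 a' ha').2]
      exact hb'.2

open Classical in
/-- The weak selection choosing the other point of each pair. -/
noncomputable def selReverse {X : Type*} (φ : X → X → X) (a b : X) : X :=
  if φ a b = a then b else a

theorem IsWeakSelection.reverse (h : IsWeakSelection φ) : IsWeakSelection (selReverse φ) := by
  have h1 := h.1
  have h2 := h.2
  constructor <;> intro a b <;> grind [selReverse]

theorem IsWeakSelection.reverse_eq_left_iff (h : IsWeakSelection φ) {a b : X} :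
    selReverse φ a b = a ↔ φ a b = b := by
  have h1 := h.1
  have h2 := h.2
  grind [selReverse]

theorem ContWeakSel.reverse [TopologicalSpace X] [T2Space X] (h : IsWeakSelection φ) (hc : ContWeakSel φ) :
    ContWeakSel (selReverse φ) := by
  refine h.reverse.contWeakSel_iff.2 fun a b hab e => ?_
  obtain ⟨U, V, hU, hV, hbU, haV, hUV⟩ := h.contWeakSel_iff.1 hc b a hab.symm
    (h.1 b a ▸ h.reverse_eq_left_iff.1 e)
  refine ⟨V, U, hV, hU, haV, hbU, fun a' ha' b' hb' => ⟨(hUV b' hb' a' ha').1.symm, ?_⟩⟩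
  rw [h.reverse_eq_left_iff, h.1]
  exact (hUV b' hb' a' ha').2

open Classical in
/-- The weak selection choosing the point with the smaller value of `f`, and following `φ` on the
fibres of `f`. -/
noncomputable def selLex {X L : Type*} [LinearOrder L] (f : X → L) (φ : X → X → X) (a b : X) : X :=
  if f a < f b then a else if f b < f a then b else φ a b

variable {L : Type*} [LinearOrder L] {f : X → L}

theorem IsWeakSelection.lex (h : IsWeakSelection φ) (f : X → L) :
    IsWeakSelection (selLex f φ) := by
  have h1 := h.1
  have h2 := h.2
  constructor <;> intro a b <;> unfold selLex
  · split_ifs with h3 h4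
    · exact absurd h4 h3.not_gt
    all_goals first | rfl | exact h1 a b
  · split_ifs
    · exact Or.inl rfl
    · exact Or.inr rfl
    · exact h2 a b

theorem ContWeakSel.lex [TopologicalSpace X] [T2Space X] (h : IsWeakSelection φ) (hc : ContWeakSel φ)
    (hf : IsLocallyConstant f) : ContWeakSel (selLex f φ) := by
  refine (h.lex f).contWeakSel_iff.2 fun a b hab e => ?_
  rcases lt_trichotomy (f a) (f b) with hlt | heq | hlt
  · refine ⟨{x | f x = f a}, {x | f x = f b}, hf.isOpen_fiber _, hf.isOpen_fiber _, rfl, rfl,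
      fun a' ha' b' hb' => ?_⟩
    have hlt' : f a' < f b' := by
      rw [show f a' = f a from ha', show f b' = f b from hb']
      exact hlt
    exact ⟨fun e => hlt'.ne (e ▸ rfl), if_pos hlt'⟩
  · have e' : φ a b = a := by simpa [selLex, heq] using e
    obtain ⟨U, V, hU, hV, haU, hbV, hUV⟩ := h.contWeakSel_iff.1 hc a b hab e'
    refine ⟨U ∩ {x | f x = f a}, V ∩ {x | f x = f a}, hU.inter (hf.isOpen_fiber _),
      hV.inter (hf.isOpen_fiber _), ⟨haU, rfl⟩, ⟨hbV, heq.symm⟩, fun a' ha' b' hb' => ?_⟩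
    have heq' : f a' = f b' := Eq.trans ha'.2 (Eq.symm hb'.2)
    simpa [selLex, heq'] using hUV a' ha'.1 b' hb'.1
  · exact absurd (by simpa [selLex, hlt, hlt.not_gt] using e) hab.symm

/-- In a king space, any locally constant map to a linear order attains its maximum, and the
restriction of any continuous weak selection to the top fibre has a king. -/
theorem IsKingSpace.exists_king_of_isLocallyConstant [TopologicalSpace X] [T2Space X] (hking : IsKingSpace X)
    (h : IsWeakSelection φ) (hc : ContWeakSel φ) (hf : IsLocallyConstant f) :
    ∃ z, (∀ x, f x ≤ f z) ∧
      ∀ x, f x = f z → ∃ y, f y = f z ∧ SelArrow φ z y ∧ SelArrow φ y x := by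
  obtain ⟨z, hz⟩ := hking _ (h.lex f) (hc.lex h hf)
  have key {a b : X} (hab : SelArrow (selLex f φ) a b) :
      f b ≤ f a ∧ (f b = f a → SelArrow φ a b) := by
    rw [(h.lex f).selArrow_iff] at hab
    rw [h.selArrow_iff]
    unfold selLex at hab
    split_ifs at hab with h1 h2
    · subst hab
      exact absurd h1 (lt_irrefl _)
    · exact ⟨h2.le, fun e => absurd e h2.ne⟩
    · exact ⟨not_lt.1 h1, fun _ => hab⟩
  refine ⟨z, fun x => ?_, fun x hx => ?_⟩
  · obtain ⟨y, hzy, hyx⟩ := hz x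
    exact (key hyx).1.trans (key hzy).1
  · obtain ⟨y, hzy, hyx⟩ := hz x
    have hy : f y = f z := le_antisymm (key hzy).1 (hx ▸ (key hyx).1)
    exact ⟨y, hy, (key hzy).2 hy, (key hyx).2 (hx.trans hy.symm)⟩

end Selection

section Connected

variable {Y : Type*} [TopologicalSpace Y] [T2Space Y] {φ : Y → Y → Y}

theorem isOpen_setOf_sel_eq_self (h : IsWeakSelection φ) (hc : ContWeakSel φ) (a : Y) :
    IsOpen {x | x ≠ a ∧ φ x a = x} := by
  refine isOpen_iff_forall_mem_open.2 fun x hx => ?_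
  obtain ⟨U, V, hU, -, hxU, haV, hUV⟩ := h.contWeakSel_iff.1 hc x a hx.1 hx.2
  exact ⟨U, fun y hy => hUV y hy a haV, hU, hxU⟩

theorem isOpen_setOf_sel_eq_right (h : IsWeakSelection φ) (hc : ContWeakSel φ) (a : Y) :
    IsOpen {x | x ≠ a ∧ φ x a = a} := by
  refine isOpen_iff_forall_mem_open.2 fun x hx => ?_
  obtain ⟨U, V, -, hV, haU, hxV, hUV⟩ :=
    h.contWeakSel_iff.1 hc a x hx.1.symm (h.1 a x ▸ hx.2)
  exact ⟨V, fun y hy => ⟨(hUV a haU y hy).1.symm, h.1 y a ▸ (hUV a haU y hy).2⟩, hV, hxV⟩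

/-- In a connected space, the points not smaller than a given point form a connected set. -/
theorem isPreconnected_setOf_sel_eq_right [PreconnectedSpace Y] (h : IsWeakSelection φ)
    (hc : ContWeakSel φ) (a : Y) : IsPreconnected {x | φ x a = a} := by
  classical
  have hself : φ a a = a := (h.2 a a).elim id id
  let s : Set Y := {x | φ x a = x}
  have hs : sᶜ = {x | x ≠ a ∧ φ x a = a} := by
    ext x
    have := h.2 x a
    simp only [s, mem_compl_iff, mem_ofPred_eq]
    grind
  have hs' : {x | φ x a = a}ᶜ = {x | x ≠ a ∧ φ x a = x} := by
    ext x
    have := h.2 x a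
    simp only [mem_compl_iff, mem_ofPred_eq]
    grind
  have hsc : IsClosed s := ⟨hs ▸ isOpen_setOf_sel_eq_right h hc a⟩
  have htc : IsClosed {x | φ x a = a} := ⟨hs' ▸ isOpen_setOf_sel_eq_self h hc a⟩
  have hcont : Continuous (s.piecewise (fun _ => a) id) := by
    refine Continuous.piecewise (fun x hx => ?_) continuous_const continuous_id
    rw [frontier_eq_closure_inter_closure, hsc.closure_eq] at hx
    have hx2 : x ∈ {x | φ x a = a} :=
      closure_minimal (hs ▸ fun y hy => hy.2) htc hx.2
    exact hx2.symm.trans hx.1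
  convert isPreconnected_range hcont
  ext x
  simp only [mem_ofPred_eq, mem_range]
  constructor
  · intro hx
    refine ⟨x, ?_⟩
    by_cases hxs : x ∈ s
    · rw [piecewise_eq_of_mem _ _ _ hxs, ← hx]
      exact hxs
    · rw [piecewise_eq_of_notMem _ _ _ hxs, id]
  · rintro ⟨y, rfl⟩
    by_cases hys : y ∈ s
    · rwa [piecewise_eq_of_mem _ _ _ hys]
    · rw [piecewise_eq_of_notMem _ _ _ hys]
      exact h.eq_right_of_ne hys

/-- A continuous weak selection on a connected space is transitive. -/
theorem ContWeakSel.trans [PreconnectedSpace Y] (h : IsWeakSelection φ)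
    (hc : ContWeakSel φ) {x y z : Y} (hxy : φ x y = x) (hyz : φ y z = y) : φ x z = x := by
  by_contra hxz
  have hne : x ≠ y := fun e => hxz (e ▸ hyz)
  have hzx : z ≠ x := fun e => hxz (by subst e; exact (h.2 z z).elim id id)
  obtain ⟨w, -, hw, hw'⟩ := isPreconnected_setOf_sel_eq_right h hc y _ _
    (isOpen_setOf_sel_eq_self h hc x) (isOpen_setOf_sel_eq_right h hc x)
    (fun w hw => by
      have hwx : w ≠ x := fun e => hne (hxy.symm.trans (e ▸ hw))
      exact (h.2 w x).imp (fun e => ⟨hwx, e⟩) fun e => ⟨hwx, e⟩)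
    ⟨z, (h.1 z y).trans hyz, hzx, (h.1 z x).trans (h.eq_right_of_ne hxz)⟩
    ⟨y, (h.2 y y).elim id id, hne.symm, (h.1 y x).trans hxy⟩
  exact hw.1 (hw.2.symm.trans hw'.2)

open Classical in
/-- The linear order induced by a continuous weak selection on a connected space. -/
noncomputable abbrev ContWeakSel.linearOrder [PreconnectedSpace Y] (h : IsWeakSelection φ)
    (hc : ContWeakSel φ) : LinearOrder Y where
  le a b := φ a b = a
  le_refl a := (h.2 a a).elim id id
  le_trans _ _ _ hab hbc := hc.trans h hab hbc
  le_antisymm a b hab hba := hab.symm.trans ((h.1 a b).trans hba)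
  le_total a b := (h.2 a b).imp id fun e => (h.1 b a).trans e
  toDecidableLE := Classical.decRel _

theorem ContWeakSel.compactSpace_of_isKing [PreconnectedSpace Y] [LocallyConnectedSpace Y]
    (h : IsWeakSelection φ) (hc : ContWeakSel φ) {m M : Y} (hM : IsKing φ M)
    (hm : IsKing (selReverse φ) m) : CompactSpace Y := by
  let := hc.linearOrder h
  have le_iff {a b : Y} : a ≤ b ↔ φ a b = a := Iff.rfl
  refine compactSpace_of_isOpen_rays (m := m) (M := M) (fun a => ?_) (fun a => ?_)
    (fun x => ?_) fun x => ?_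
  · convert isOpen_setOf_sel_eq_self h hc a using 1
    ext x
    rw [mem_Iio, lt_iff_le_and_ne, le_iff, and_comm]
    rfl
  · convert isOpen_setOf_sel_eq_right h hc a using 1
    ext x
    rw [mem_Ioi, lt_iff_le_and_ne, le_iff, and_comm, h.1, ne_comm]
    rfl
  · obtain ⟨y, hmy, hyx⟩ := hm x
    rw [h.reverse.selArrow_iff, h.reverse.1, h.reverse_eq_left_iff, h.1] at hmy hyx
    exact le_trans (le_iff.2 hmy) (le_iff.2 hyx)
  · obtain ⟨y, hMy, hyx⟩ := hM x
    rw [h.selArrow_iff, h.1] at hMy hyx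
    exact le_trans (le_iff.2 hyx) (le_iff.2 hMy)

end Connected

section Restriction

variable {X : Type*} {φ : X → X → X}

/-- The restriction of a weak selection to a subset. -/
def IsWeakSelection.restrict (h : IsWeakSelection φ) (C : Set X) (a b : C) : C :=
  ⟨φ a b, (h.2 a b).elim (fun e => e.symm ▸ a.2) fun e => e.symm ▸ b.2⟩

theorem IsWeakSelection.isWeakSelection_restrict (h : IsWeakSelection φ) (C : Set X) :
    IsWeakSelection (h.restrict C) :=
  ⟨fun a b => Subtype.ext (h.1 a b),
    fun a b => (h.2 a b).imp (fun e => Subtype.ext e) fun e => Subtype.ext e⟩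

theorem ContWeakSel.restrict [TopologicalSpace X] [T2Space X] (h : IsWeakSelection φ)
    (hc : ContWeakSel φ) (C : Set X) : ContWeakSel (h.restrict C) := by
  refine (h.isWeakSelection_restrict C).contWeakSel_iff.2 fun a b hab e => ?_
  obtain ⟨U, V, hU, hV, haU, hbV, hUV⟩ := h.contWeakSel_iff.1 hc a b
    (fun e => hab (Subtype.ext e)) (congrArg Subtype.val e)
  refine ⟨Subtype.val ⁻¹' U, Subtype.val ⁻¹' V, hU.preimage continuous_subtype_val,
    hV.preimage continuous_subtype_val, haU, hbV, fun a' ha' b' hb' => ?_⟩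
  exact ⟨fun e => (hUV a' ha' b' hb').1 (congrArg Subtype.val e),
    Subtype.ext (hUV a' ha' b' hb').2⟩

end Restriction

section KingSpace

variable {X : Type*} [TopologicalSpace X] [T2Space X] {φ : X → X → X}

/-- In a king space, every nonempty clopen set contains a king for itself. -/
theorem IsKingSpace.exists_king_of_isClopen (hking : IsKingSpace X) (h : IsWeakSelection φ)
    (hc : ContWeakSel φ) {C : Set X} (hC : IsClopen C) (hne : C.Nonempty) :
    ∃ z ∈ C, ∀ x ∈ C, ∃ y ∈ C, SelArrow φ z y ∧ SelArrow φ y x := by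
  have hf : IsLocallyConstant (fun x => x ∈ C) := by
    refine (IsLocallyConstant.iff_eventually_eq _).2 fun x => ?_
    by_cases hx : x ∈ C
    · filter_upwards [hC.isOpen.mem_nhds hx] with y hy
      simp [hx, hy]
    · filter_upwards [hC.compl.isOpen.mem_nhds hx] with y hy
      simpa [hx] using hy
  obtain ⟨z, hmax, hz⟩ := hking.exists_king_of_isLocallyConstant h hc hf
  obtain ⟨c, hcC⟩ := hne
  have hzC : z ∈ C := hmax c hcC
  refine ⟨z, hzC, fun x hx => ?_⟩
  obtain ⟨y, hy, hzy, hyx⟩ := hz x (by simp [hx, hzC])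
  exact ⟨y, hy.symm.mp hzC, hzy, hyx⟩

theorem IsKingSpace.isCompact_connectedComponent [LocallyConnectedSpace X] (hking : IsKingSpace X)
    (h : IsWeakSelection φ) (hc : ContWeakSel φ) (x : X) : IsCompact (connectedComponent x) := by
  have hC : IsClopen (connectedComponent x) := isClopen_connectedComponent
  have hne : (connectedComponent x).Nonempty := ⟨x, mem_connectedComponent⟩
  have hr := h.isWeakSelection_restrict (connectedComponent x)
  have : PreconnectedSpace (connectedComponent x) :=
    Subtype.preconnectedSpace isPreconnected_connectedComponent
  have : LocallyConnectedSpace (connectedComponent x) := hC.isOpen.locallyConnectedSpace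
  obtain ⟨M, hMC, hM⟩ := hking.exists_king_of_isClopen h hc hC hne
  obtain ⟨m, hmC, hm⟩ := hking.exists_king_of_isClopen h.reverse (hc.reverse h) hC hne
  refine isCompact_iff_compactSpace.2
    (ContWeakSel.compactSpace_of_isKing hr (hc.restrict h _) (M := ⟨M, hMC⟩) (m := ⟨m, hmC⟩) ?_ ?_)
  · rintro ⟨x, hx⟩
    obtain ⟨y, hy, hMy, hyx⟩ := hM x hx
    refine ⟨⟨y, hy⟩, ?_⟩
    rw [h.selArrow_iff] at hMy hyx
    rw [hr.selArrow_iff, hr.selArrow_iff]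
    exact ⟨Subtype.ext hMy, Subtype.ext hyx⟩
  · rintro ⟨x, hx⟩
    obtain ⟨y, hy, hmy, hyx⟩ := hm x hx
    refine ⟨⟨y, hy⟩, ?_⟩
    rw [h.reverse.selArrow_iff, h.reverse.1, h.reverse_eq_left_iff] at hmy hyx
    rw [hr.reverse.selArrow_iff, hr.reverse.selArrow_iff, hr.reverse.1,
      hr.reverse_eq_left_iff, hr.reverse.1, hr.reverse_eq_left_iff]
    exact ⟨Subtype.ext hmy, Subtype.ext hyx⟩

theorem IsKingSpace.finite_connectedComponents [LocallyConnectedSpace X] (hking : IsKingSpace X)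
    (h : IsWeakSelection φ) (hc : ContWeakSel φ) : Finite (ConnectedComponents X) := by
  by_contra hinf
  rw [not_finite_iff_infinite] at hinf
  have : NoMaxOrder (Cardinal.mk (ConnectedComponents X)).ord.ToType :=
    Cardinal.noMaxOrder (Cardinal.aleph0_le_mk _)
  obtain ⟨e⟩ : Nonempty (ConnectedComponents X ≃ (Cardinal.mk (ConnectedComponents X)).ord.ToType) :=
    Cardinal.eq.1 (Cardinal.mk_ord_toType _).symm
  have hf : IsLocallyConstant fun x : X => e (ConnectedComponents.mk x) := by
    refine (IsLocallyConstant.iff_eventually_eq _).2 fun x => ?_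
    filter_upwards [isOpen_connectedComponent.mem_nhds (mem_connectedComponent (x := x))] with y hy
    rw [ConnectedComponents.coe_eq_coe'.2 hy]
  obtain ⟨z, hmax, -⟩ := hking.exists_king_of_isLocallyConstant h hc hf
  obtain ⟨i, hi⟩ := exists_gt (e (ConnectedComponents.mk z))
  obtain ⟨x, hx⟩ := ConnectedComponents.surjective_coe (e.symm i)
  have := hmax x
  rw [hx, e.apply_symm_apply] at this
  exact this.not_gt hi

end KingSpace

/-- A locally connected Tychonoff king space with at least one continuous weak
selection is compact. -/
theorem locally_connected_king_compact {X : Type*} [TopologicalSpace X]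
    [T2Space X] [CompletelyRegularSpace X]
    (hsel : ∃ ψ : X → X → X, IsWeakSelection ψ ∧ ContWeakSel ψ)
    (hking : IsKingSpace X)
    (hlc : ∀ U : Set X, IsOpen U → ∀ x ∈ U, ∃ V C : Set X,
      IsOpen V ∧ IsPreconnected C ∧ x ∈ V ∧ V ⊆ C ∧ C ⊆ U) :
    CompactSpace X := by
  obtain ⟨φ, h, hc⟩ := hsel
  have : LocallyConnectedSpace X := by
    refine locallyConnectedSpace_iff_connected_subsets.2 fun x U hU => ?_
    obtain ⟨W, hWU, hW, hxW⟩ := mem_nhds_iff.1 hU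
    obtain ⟨V, C, hV, hC, hxV, hVC, hCW⟩ := hlc W hW x hxW
    exact ⟨C, Filter.mem_of_superset (hV.mem_nhds hxV) hVC, hC, hCW.trans hWU⟩
  have := hking.finite_connectedComponents h hc
  refine ⟨?_⟩
  rw [show (Set.univ : Set X) = ⋃ c : ConnectedComponents X, ConnectedComponents.mk ⁻¹' {c} by
    ext; simp]
  refine isCompact_iUnion fun c => ?_
  obtain ⟨x, rfl⟩ := ConnectedComponents.surjective_coe c
  rw [connectedComponents_preimage_singleton]
  exact hking.isCompact_connectedComponent h hc x
end

section
/- Let I = [0,1] and let f : I → I be a function whose graph X^f = {(s, f(s)) : s ∈ I}, with the subspace topology inherited from I × I, is connected. Then X^f is a king space; moreover, X^f has precisely two continuous weak selections, namely σ_min({(s,f(s)), (t,f(t))}) = (min{s,t}, f(min{s,t})) and σ_max({(s,f(s)), (t,f(t))}) = (max{s,t}, f(max{s,t})). -/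
section WeakSelection

variable {X : Type*} [TopologicalSpace X]

theorem ContWeakSel.isOpen_setOf_eq_left [T2Space X] {φ : X → X → X} (hw : IsWeakSelection φ)
    (hc : ContWeakSel φ) {Y : Type*} [TopologicalSpace Y] {c d : Y → X} (hcc : Continuous c)
    (hd : Continuous d) (hne : ∀ y, c y ≠ d y) : IsOpen {y | φ (c y) (d y) = c y} := by
  rw [isOpen_iff_mem_nhds]
  intro y hy
  obtain ⟨W, W', hW, hW', hyW, hyW', hdisj⟩ := t2_separation (hne y)
  have hy' : φ (c y) (d y) = c y := hy
  obtain ⟨U, V, hU, hV, hyU, hyV, h⟩ := hc (c y) (d y) (hne y) W hW (by rwa [hy'])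
  filter_upwards [hcc.continuousAt (hU.mem_nhds hyU), hd.continuousAt (hV.mem_nhds hyV),
    hd.continuousAt (hW'.mem_nhds hyW')] with z hzU hzV hzW'
  refine (hw.2 (c z) (d z)).resolve_right fun hz => ?_
  have hzW := h _ hzU _ hzV (hne z)
  rw [hz] at hzW
  exact Set.disjoint_left.1 hdisj hzW hzW'

theorem ContWeakSel.eq_left_iff_eq_left [T2Space X] {φ : X → X → X} (hw : IsWeakSelection φ)
    (hc : ContWeakSel φ) {Y : Type*} [TopologicalSpace Y] [PreconnectedSpace Y] {c d : Y → X}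
    (hcc : Continuous c) (hd : Continuous d) (hne : ∀ y, c y ≠ d y) (y z : Y) :
    φ (c y) (d y) = c y ↔ φ (c z) (d z) = c z := by
  have hcompl : {y | φ (c y) (d y) = c y}ᶜ = {y | φ (d y) (c y) = d y} := by
    ext y
    simp only [Set.mem_compl_iff, Set.mem_ofPred_eq, hw.1 (d y) (c y)]
    exact ⟨fun h => (hw.2 _ _).resolve_left h, fun h h' => hne y (h'.symm.trans h)⟩
  have hclopen : IsClopen {y | φ (c y) (d y) = c y} :=
    ⟨⟨hcompl ▸ hc.isOpen_setOf_eq_left hw hd hcc fun y => (hne y).symm⟩,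
      hc.isOpen_setOf_eq_left hw hcc hd hne⟩
  change y ∈ {y | φ (c y) (d y) = c y} ↔ z ∈ {y | φ (c y) (d y) = c y}
  rcases isClopen_iff.1 hclopen with h | h <;> simp [h]

theorem Continuous.contWeakSel {φ : X → X → X} (h : Continuous fun p : X × X => φ p.1 p.2) :
    ContWeakSel φ := by
  intro a b _ W hW hab
  obtain ⟨U, V, hU, hV, haU, hbV, hUV⟩ := isOpen_prod_iff.1 (hW.preimage h) a b hab
  exact ⟨U, V, hU, hV, haU, hbV, fun a' ha' b' hb' _ => hUV (Set.mk_mem_prod ha' hb')⟩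

theorem isWeakSelection_min {X : Type*} [LinearOrder X] :
    IsWeakSelection (min : X → X → X) :=
  ⟨min_comm, min_choice⟩

theorem isWeakSelection_max {X : Type*} [LinearOrder X] :
    IsWeakSelection (max : X → X → X) :=
  ⟨max_comm, max_choice⟩

theorem isKing_of_forall_selArrow {X : Type*} {φ : X → X → X} {z : X}
    (h : ∀ x, φ z x = x) : IsKing φ z := fun x => by
  refine ⟨x, ?_, Or.inl rfl⟩
  by_cases hx : z = x
  exacts [Or.inl hx, Or.inr ⟨hx, h x⟩]

theorem IsWeakSelection.ext_of_lt {X : Type*} [LinearOrder X] {φ ψ : X → X → X}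
    (hφ : IsWeakSelection φ) (hψ : IsWeakSelection ψ) (h : ∀ p q, p < q → φ p q = ψ p q) :
    φ = ψ := by
  funext p q
  rcases lt_trichotomy p q with hpq | rfl | hqp
  · exact h p q hpq
  · exact ((or_self_iff.1 (hφ.2 p p)).trans (or_self_iff.1 (hψ.2 p p)).symm)
  · rw [hφ.1, hψ.1, h q p hqp]

theorem ContWeakSel.eq_min_or_eq_max [LinearOrder X] [OrderClosedTopology X]
    [PreconnectedSpace X] [BoundedOrder X] {φ : X → X → X} (hw : IsWeakSelection φ)
    (hc : ContWeakSel φ) : φ = min ∨ φ = max := by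
  have key : ∀ p q : X, p < q → (φ p q = p ↔ φ ⊥ ⊤ = ⊥) := by
    intro p q hpq
    have h₁ := hc.eq_left_iff_eq_left hw (c := fun x => min x p) (d := fun _ => q)
      (by fun_prop) (by fun_prop) (fun x => ((min_le_right x p).trans_lt hpq).ne) p ⊥
    have h₂ := hc.eq_left_iff_eq_left hw (c := fun _ => ⊥) (d := fun x => max x q)
      (by fun_prop) (by fun_prop)
      (fun x => ((bot_le.trans_lt hpq).trans_le (le_max_right x q)).ne) q ⊤
    simp only [min_self, bot_le, inf_of_le_left] at h₁
    simp only [max_self, le_top, sup_of_le_left] at h₂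
    exact h₁.trans h₂
  by_cases h : φ ⊥ ⊤ = ⊥
  · refine Or.inl (hw.ext_of_lt isWeakSelection_min fun p q hpq => ?_)
    rw [min_eq_left hpq.le, (key p q hpq).2 h]
  · refine Or.inr (hw.ext_of_lt isWeakSelection_max fun p q hpq => ?_)
    rw [max_eq_right hpq.le]
    exact (hw.2 p q).resolve_left fun h' => h ((key p q hpq).1 h')

/-- In a nondegenerate connected linearly ordered space with endpoints and a topology in which the
order is closed, `min` and `max` are precisely the continuous weak selections, and each has a
king. -/
theorem weakSelection_classification (X : Type*) [TopologicalSpace X] [LinearOrder X]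
    [OrderClosedTopology X] [PreconnectedSpace X] [BoundedOrder X] [Nontrivial X] :
    IsKingSpace X ∧
    IsWeakSelection (min : X → X → X) ∧ ContWeakSel (min : X → X → X) ∧
    IsWeakSelection (max : X → X → X) ∧ ContWeakSel (max : X → X → X) ∧
    (min : X → X → X) ≠ max ∧
    ∀ φ : X → X → X, IsWeakSelection φ → ContWeakSel φ → φ = min ∨ φ = max := by
  refine ⟨fun φ hw hc => ?_, isWeakSelection_min, Continuous.contWeakSel (by fun_prop),
    isWeakSelection_max, Continuous.contWeakSel (by fun_prop), fun h => ?_,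
    fun φ hw hc => hc.eq_min_or_eq_max hw⟩
  · rcases hc.eq_min_or_eq_max hw with rfl | rfl
    · exact ⟨⊤, isKing_of_forall_selArrow fun x => min_eq_right le_top⟩
    · exact ⟨⊥, isKing_of_forall_selArrow fun x => max_eq_right bot_le⟩
  · exact bot_ne_top (α := X) (by simpa using congrFun (congrFun h ⊥) ⊤)

/-- The classification of continuous weak selections on a connected space whose order is pulled
back along a continuous injection `g` attaining its bounds. -/
theorem weakSelection_classification_of_injective {X α : Type*} [TopologicalSpace X]
    [PreconnectedSpace X] [LinearOrder α] [TopologicalSpace α] [OrderClosedTopology α]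
    {g : X → α} (hg : Continuous g) (hinj : Function.Injective g) {a b : X} (hab : a ≠ b)
    (ha : ∀ x, g a ≤ g x) (hb : ∀ x, g x ≤ g b) {σmin σmax : X → X → X}
    (hmin : ∀ p q, σmin p q = if g p ≤ g q then p else q)
    (hmax : ∀ p q, σmax p q = if g p ≤ g q then q else p) :
    IsKingSpace X ∧
    IsWeakSelection σmin ∧ ContWeakSel σmin ∧
    IsWeakSelection σmax ∧ ContWeakSel σmax ∧
    σmin ≠ σmax ∧
    ∀ φ : X → X → X, IsWeakSelection φ → ContWeakSel φ → φ = σmin ∨ φ = σmax := by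
  have hclosed : IsClosed {p : X × X | g p.1 ≤ g p.2} :=
    isClosed_le (hg.comp continuous_fst) (hg.comp continuous_snd)
  let : LinearOrder X := LinearOrder.lift' g hinj
  have : OrderClosedTopology X := ⟨hclosed⟩
  let : BoundedOrder X := { top := b, le_top := hb, bot := a, bot_le := ha }
  have : Nontrivial X := ⟨a, b, hab⟩
  obtain rfl : σmin = min := by
    funext p q
    rw [hmin, min_def]
    rfl
  obtain rfl : σmax = max := by
    funext p q
    rw [hmax, max_def]
    rfl
  exact weakSelection_classification X

end WeakSelection

open unitInterval in
/-- If the graph of `f : I → I` is connected, then it is a king space with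
precisely two continuous weak selections, namely the min- and max- selections. -/
theorem connected_graph_king (f : unitInterval → unitInterval)
    (Xf : Set (unitInterval × unitInterval))
    (hXf : Xf = {p : unitInterval × unitInterval | p.2 = f p.1})
    (hconn : IsConnected Xf)
    (σmin σmax : Xf → Xf → Xf)
    (hmin : ∀ p q : Xf, σmin p q = if p.val.1 ≤ q.val.1 then p else q)
    (hmax : ∀ p q : Xf, σmax p q = if p.val.1 ≤ q.val.1 then q else p) :
    IsKingSpace Xf ∧
    IsWeakSelection σmin ∧ ContWeakSel σmin ∧
    IsWeakSelection σmax ∧ ContWeakSel σmax ∧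
    σmin ≠ σmax ∧
    ∀ φ : Xf → Xf → Xf, IsWeakSelection φ → ContWeakSel φ →
      φ = σmin ∨ φ = σmax := by
  subst hXf
  set G := {p : unitInterval × unitInterval | p.2 = f p.1}
  have hinj : Function.Injective fun p : G => p.val.1 := fun p q h =>
    Subtype.ext (Prod.ext h (by
      have hp : p.val.2 = f p.val.1 := p.2
      have hq : q.val.2 = f q.val.1 := q.2
      rw [hp, hq]
      exact congrArg f h))
  have : PreconnectedSpace G := Subtype.preconnectedSpace hconn.isPreconnected
  exact weakSelection_classification_of_injective
    (continuous_fst.comp continuous_subtype_val) hinj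
    (a := ⟨(0, f 0), rfl⟩) (b := ⟨(1, f 1), rfl⟩)
    (fun h => zero_ne_one (congrArg (fun p : G => p.val.1) h))
    (fun _ => unitInterval.nonneg') (fun _ => unitInterval.le_one') hmin hmax
end

section
/- Let I = [0,1] and let f : I → I be defined by f(0) = 0 and f(t) = |sin(1/t)| for 0 < t ≤ 1. Then the graph X^f = {(s, f(s)) : s ∈ I}, with the subspace topology inherited from I × I, is a connected, non-compact, completely metrizable separable king space. -/
open Set Filter Topology

/-- A `Gδ` subset of a Polish space is Polish. -/
theorem IsGδ.polishSpace_coe {α : Type*} [TopologicalSpace α] [PolishSpace α] {s : Set α}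
    (hs : IsGδ s) : PolishSpace s := by
  obtain ⟨U, hU, rfl⟩ := hs.eq_iInter_nat
  have := fun n => (hU n).polishSpace
  let e : (⋂ n, U n : Set α) → ∀ n, U n := fun x n => ⟨x.1, mem_iInter.1 x.2 n⟩
  have he : Continuous e :=
    continuous_pi fun n => Continuous.subtype_mk continuous_subtype_val _
  have hv : Continuous fun x : ∀ n, U n => (x 0 : α) :=
    continuous_subtype_val.comp (continuous_apply 0)
  have hemb : IsEmbedding e := IsEmbedding.of_comp he hv IsEmbedding.subtypeVal
  have hrange : range e = {x | ∀ n, (x n : α) = x 0} := by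
    ext x
    constructor
    · rintro ⟨y, rfl⟩ n
      rfl
    · intro hx
      refine ⟨⟨x 0, mem_iInter.2 fun n => hx n ▸ (x n).2⟩, ?_⟩
      funext n
      exact Subtype.ext (hx n).symm
  refine IsClosedEmbedding.polishSpace (f := e) ⟨hemb, ?_⟩
  rw [hrange, ofPred_forall]
  exact isClosed_iInter fun n =>
    isClosed_eq (continuous_subtype_val.comp (continuous_apply n)) hv

/-- For a continuous weak selection on a Hausdorff space, the off-diagonal pairs whose first
coordinate is selected form an open set. -/
theorem ContWeakSel.isOpen_setOf_eq_left_s13 {X : Type*} [TopologicalSpace X] [T2Space X]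
    {φ : X → X → X} (hφ : IsWeakSelection φ) (hc : ContWeakSel φ) :
    IsOpen {p : X × X | p.1 ≠ p.2 ∧ φ p.1 p.2 = p.1} := by
  rw [isOpen_iff_mem_nhds]
  rintro ⟨a, b⟩ ⟨hab, h⟩
  obtain ⟨A, B, hA, hB, haA, hbB, hAB⟩ := t2_separation hab
  obtain ⟨U, V, hU, hV, haU, hbV, hUV⟩ := hc a b hab A hA (by rwa [h])
  filter_upwards [prod_mem_nhds ((hU.inter hA).mem_nhds ⟨haU, haA⟩)
    ((hV.inter hB).mem_nhds ⟨hbV, hbB⟩)]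
  rintro ⟨x, y⟩ ⟨⟨hxU, hxA⟩, hyV, hyB⟩
  have hxy : x ≠ y := fun e => hAB.ne_of_mem hxA hyB e
  refine ⟨hxy, (hφ.2 x y).resolve_right fun e => ?_⟩
  exact hAB.ne_of_mem (e ▸ hUV x hxU y hyV hxy) hyB rfl

/-- If a Hausdorff space carries an injection into a linear order which attains its extrema and
such that the strictly increasing pairs form a connected set, then the space is a king space. -/
theorem isKingSpace_of_isPreconnected {X α : Type*} [TopologicalSpace X] [T2Space X]
    [LinearOrder α] {π : X → α} (hπ : π.Injective)
    (hD : IsPreconnected {p : X × X | π p.1 < π p.2}) {l u : X}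
    (hl : ∀ x, π l ≤ π x) (hu : ∀ x, π x ≤ π u) : IsKingSpace X := by
  intro φ hφ hc
  have hopen := ContWeakSel.isOpen_setOf_eq_left_s13 hφ hc
  have hopen' := hopen.preimage continuous_swap
  have hne {x y : X} (h : π x < π y) : x ≠ y := fun e => h.ne (congrArg π e)
  have hor := isPreconnected_iff_subset_of_disjoint.1 hD _ _ hopen hopen'
    (by
      rintro ⟨x, y⟩ hxy
      refine (hφ.2 x y).imp (fun h => ⟨hne hxy, h⟩) fun h => ⟨(hne hxy).symm, ?_⟩
      exact (hφ.1 y x).trans h)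
    (by
      refine eq_empty_of_forall_notMem ?_
      rintro ⟨x, y⟩ ⟨-, ⟨h, h₁⟩, -, h₂⟩
      exact h (h₁.symm.trans ((hφ.1 x y).trans h₂)))
  rcases hor with h | h
  · refine ⟨u, fun x => ⟨x, ?_, Or.inl rfl⟩⟩
    rcases eq_or_ne u x with e | e
    · exact Or.inl e
    · have hlt : π x < π u := (hu x).lt_of_ne fun h' => e (hπ h').symm
      exact Or.inr ⟨e, (hφ.1 u x).trans (h (show (x, u) ∈ _ from hlt)).2⟩
  · refine ⟨l, fun x => ⟨x, ?_, Or.inl rfl⟩⟩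
    rcases eq_or_ne l x with e | e
    · exact Or.inl e
    · have hlt : π l < π x := (hl x).lt_of_ne fun h' => e (hπ h')
      exact Or.inr ⟨e, (hφ.1 l x).trans (h (show (l, x) ∈ _ from hlt)).2⟩

/-- The pairs `0 < s < t` in the unit interval form a connected set. -/
theorem unitInterval.isPreconnected_setOf_pos_lt :
    IsPreconnected {p : unitInterval × unitInterval | 0 < p.1 ∧ p.1 < p.2} := by
  have h : IsPreconnected (Ioo (0 : unitInterval) 1 ×ˢ Ioi (0 : unitInterval)) :=
    isPreconnected_Ioo.prod isPreconnected_Ioi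
  convert h.image (fun p => (p.1 * p.2, p.2)) (by fun_prop) using 1
  ext ⟨s, t⟩
  constructor
  · rintro ⟨hs, hst⟩
    have hs' : (0 : ℝ) < s := hs
    have hst' : (s : ℝ) < t := hst
    have ht' : (0 : ℝ) < t := hs'.trans hst'
    refine ⟨(⟨s / t, unitInterval.div_mem hs'.le ht'.le hst'.le⟩, t), ⟨⟨?_, ?_⟩, hs.trans hst⟩, ?_⟩
    · exact Subtype.coe_lt_coe.1 (div_pos hs' ht')
    · exact Subtype.coe_lt_coe.1 ((div_lt_one ht').2 hst')
    · exact Prod.ext (Subtype.ext (div_mul_cancel₀ _ ht'.ne')) rfl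
  · rintro ⟨⟨a, b⟩, ⟨⟨ha, ha'⟩, hb⟩, h⟩
    obtain ⟨rfl, rfl⟩ := Prod.mk.inj h
    have ha₀ : (0 : ℝ) < a := ha
    have ha₁ : (a : ℝ) < 1 := ha'
    have hb₀ : (0 : ℝ) < b := hb
    exact ⟨Subtype.coe_lt_coe.1 (mul_pos ha₀ hb₀),
      Subtype.coe_lt_coe.1 (mul_lt_of_lt_one_left hb₀ ha₁)⟩

section Graph

variable {f : unitInterval → unitInterval}

/-- The canonical parametrization of the graph of `f`. -/
def graphPoint (f : unitInterval → unitInterval) (t : unitInterval) :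
    {p : unitInterval × unitInterval | p.2 = f p.1} :=
  ⟨(t, f t), rfl⟩

theorem graphPoint_fst (x : {p : unitInterval × unitInterval | p.2 = f p.1}) :
    graphPoint f x.1.1 = x :=
  Subtype.ext (Prod.ext rfl x.2.symm)

theorem continuousOn_graphPoint (hf : ContinuousOn f (Ioi 0)) :
    ContinuousOn (graphPoint f) (Ioi 0) :=
  IsInducing.subtypeVal.continuousOn_iff.2 (continuousOn_id.prodMk hf)

theorem tendsto_graphPoint {u : ℕ → unitInterval} (hu : Tendsto u atTop (𝓝 0))
    (hfu : ∀ n, f (u n) = f 0) :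
    Tendsto (fun n => graphPoint f (u n)) atTop (𝓝 (graphPoint f 0)) := by
  refine tendsto_subtype_rng.2 (hu.prodMk_nhds ?_)
  simp only [hfu]
  exact tendsto_const_nhds

theorem isConnected_graph (hf : ContinuousOn f (Ioi 0)) {u : ℕ → unitInterval}
    (hu : Tendsto u atTop (𝓝 0)) (hupos : ∀ n, 0 < u n) (hfu : ∀ n, f (u n) = f 0) :
    IsConnected {p : unitInterval × unitInterval | p.2 = f p.1} := by
  rw [isConnected_iff_connectedSpace, connectedSpace_iff_univ]
  refine ⟨⟨graphPoint f 0, mem_univ _⟩,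
    (isPreconnected_Ioi.image _ (continuousOn_graphPoint hf)).subset_closure (subset_univ _) ?_⟩
  intro x _
  rw [← graphPoint_fst x]
  rcases eq_or_lt_of_le (unitInterval.nonneg' (t := x.1.1)) with h | h
  · rw [← h]
    exact mem_closure_of_tendsto (tendsto_graphPoint hu hfu)
      (Eventually.of_forall fun n => mem_image_of_mem _ (hupos n))
  · exact subset_closure (mem_image_of_mem _ h)

theorem isPreconnected_graph_lt (hf : ContinuousOn f (Ioi 0)) {u : ℕ → unitInterval}
    (hu : Tendsto u atTop (𝓝 0)) (hupos : ∀ n, 0 < u n) (hfu : ∀ n, f (u n) = f 0) :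
    IsPreconnected {p : {p : unitInterval × unitInterval | p.2 = f p.1} ×
      {p : unitInterval × unitInterval | p.2 = f p.1} | p.1.1.1 < p.2.1.1} := by
  have hg : ContinuousOn (Prod.map (graphPoint f) (graphPoint f))
      {p : unitInterval × unitInterval | 0 < p.1 ∧ p.1 < p.2} :=
    ((continuousOn_graphPoint hf).prodMap (continuousOn_graphPoint hf)).mono
      fun p hp => ⟨hp.1, hp.1.trans hp.2⟩
  refine (unitInterval.isPreconnected_setOf_pos_lt.image _ hg).subset_closure ?_ ?_
  · rintro _ ⟨p, hp, rfl⟩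
    exact hp.2
  · rintro ⟨x, y⟩ (hxy : x.1.1 < y.1.1)
    rw [← graphPoint_fst x, ← graphPoint_fst y]
    rcases eq_or_lt_of_le (unitInterval.nonneg' (t := x.1.1)) with h | h
    · rw [← h] at hxy ⊢
      refine mem_closure_of_tendsto ((tendsto_graphPoint hu hfu).prodMk_nhds tendsto_const_nhds) ?_
      filter_upwards [hu.eventually_lt_const hxy] with n hn
      exact ⟨(u n, y.1.1), ⟨hupos n, hn⟩, rfl⟩
    · exact subset_closure ⟨(x.1.1, y.1.1), ⟨h, hxy⟩, rfl⟩

theorem isKingSpace_graph (hf : ContinuousOn f (Ioi 0)) {u : ℕ → unitInterval}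
    (hu : Tendsto u atTop (𝓝 0)) (hupos : ∀ n, 0 < u n) (hfu : ∀ n, f (u n) = f 0) :
    IsKingSpace {p : unitInterval × unitInterval | p.2 = f p.1} := by
  refine isKingSpace_of_isPreconnected (π := fun x => x.1.1) (fun x y h => ?_)
    (isPreconnected_graph_lt hf hu hupos hfu) (l := graphPoint f 0) (u := graphPoint f 1)
    (fun x => unitInterval.nonneg') (fun x => unitInterval.le_one')
  rw [← graphPoint_fst x, ← graphPoint_fst y]
  exact congrArg _ h

theorem polishSpace_graph (hf : ContinuousOn f (Ioi 0)) :
    PolishSpace {p : unitInterval × unitInterval | p.2 = f p.1} := by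
  apply IsGδ.polishSpace_coe
  have hg : ContinuousOn (fun p : unitInterval × unitInterval => (p.2, f p.1))
      (Prod.fst ⁻¹' Ioi 0) :=
    continuousOn_snd.prodMk (hf.comp continuousOn_fst fun _ h => h)
  obtain ⟨C, hC, hCeq⟩ := continuousOn_iff_isClosed.1 hg _ isClosed_diagonal
  have hset : {p : unitInterval × unitInterval | p.2 = f p.1} =
      C ∩ Prod.fst ⁻¹' Ioi 0 ∪ {(0, f 0)} := by
    rw [← hCeq]
    ext ⟨s, t⟩
    simp only [mem_ofPred_eq, mem_union, mem_inter_iff, mem_preimage, mem_diagonal_iff, mem_Ioi,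
      mem_singleton_iff, Prod.mk.injEq]
    constructor
    · intro h
      rcases eq_or_lt_of_le (unitInterval.nonneg' (t := s)) with h' | h'
      · exact Or.inr ⟨h'.symm, h' ▸ h⟩
      · exact Or.inl ⟨h, h'⟩
    · rintro (⟨h, -⟩ | ⟨rfl, h⟩) <;> exact h
  rw [hset]
  exact (hC.isGδ.inter (isOpen_Ioi.preimage continuous_fst).isGδ).union isClosed_singleton.isGδ

theorem not_compactSpace_graph {v : ℕ → unitInterval} {c : unitInterval}
    (hv : Tendsto v atTop (𝓝 0)) (hfv : ∀ n, f (v n) = c) (hc : c ≠ f 0) :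
    ¬ CompactSpace {p : unitInterval × unitInterval | p.2 = f p.1} := by
  intro h
  have hclosed := (isCompact_iff_compactSpace.2 h).isClosed
  refine hc (hclosed.mem_of_tendsto (hv.prodMk_nhds (tendsto_const_nhds (x := c)))
    (Eventually.of_forall fun n => (hfv n).symm))

end Graph

/-- The inverses of an arithmetic progression of step `π` starting at `c ≥ 1`, as a sequence in the
unit interval. -/
theorem exists_seq_unitInterval_inv {c : ℝ} (hc : 1 ≤ c) :
    ∃ u : ℕ → unitInterval, Tendsto u atTop (𝓝 0) ∧ (∀ n, 0 < u n) ∧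
      ∀ n, (u n : ℝ) = (c + n * Real.pi)⁻¹ := by
  have h (n : ℕ) : 1 ≤ c + n * Real.pi := by
    have := mul_nonneg n.cast_nonneg Real.pi_pos.le
    linarith
  refine ⟨fun n => ⟨(c + n * Real.pi)⁻¹, by have := h n; positivity, inv_le_one_of_one_le₀ (h n)⟩,
    ?_, fun n => ?_, fun n => rfl⟩
  · refine tendsto_subtype_rng.2 (tendsto_inv_atTop_zero.comp ?_)
    exact tendsto_atTop_add_const_left _ _
      (tendsto_natCast_atTop_atTop.atTop_mul_const Real.pi_pos)
  · exact Subtype.coe_lt_coe.1 (inv_pos.2 (zero_lt_one.trans_le (h n)))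

open unitInterval in
/-- With `f(0) = 0` and `f(t) = |sin(1/t)|` for `0 < t ≤ 1`, the graph of `f`
is a non-compact connected completely metrizable separable king space. -/
theorem sin_graph_king (f : unitInterval → unitInterval)
    (hf : ∀ t : unitInterval, (f t : ℝ) =
      if (t : ℝ) = 0 then 0 else |Real.sin (1 / (t : ℝ))|)
    (Xf : Set (unitInterval × unitInterval))
    (hXf : Xf = {p : unitInterval × unitInterval | p.2 = f p.1}) :
    IsConnected Xf ∧ ¬ CompactSpace Xf ∧ PolishSpace Xf ∧ IsKingSpace Xf := by
  subst hXf
  have h0 : f 0 = 0 := Subtype.ext (by simp [hf])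
  have hval {t : unitInterval} (ht : 0 < t) : (f t : ℝ) = |Real.sin (1 / (t : ℝ))| := by
    rw [hf, if_neg (unitInterval.coe_ne_zero.2 ht.ne')]
  have hcont : ContinuousOn f (Ioi 0) := by
    refine IsInducing.subtypeVal.continuousOn_iff.2 ?_
    refine ContinuousOn.congr (f := fun t : unitInterval => |Real.sin (1 / (t : ℝ))|) ?_
      fun t ht => hval ht
    refine (Real.continuous_sin.comp_continuousOn ?_).abs
    exact continuousOn_const.div continuous_subtype_val.continuousOn
      fun t ht => unitInterval.coe_ne_zero.2 (ne_of_gt ht)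
  obtain ⟨u, hu, hupos, hueq⟩ := exists_seq_unitInterval_inv (c := Real.pi)
    (by linarith [Real.pi_gt_three])
  obtain ⟨v, hv, hvpos, hveq⟩ := exists_seq_unitInterval_inv (c := Real.pi / 2)
    (by linarith [Real.pi_gt_three])
  have hfu (n : ℕ) : f (u n) = f 0 := by
    rw [h0]
    refine Subtype.ext ?_
    rw [hval (hupos n), hueq, one_div, inv_inv, Real.sin_add_nat_mul_pi]
    simp
  have hfv (n : ℕ) : f (v n) = 1 := by
    refine Subtype.ext ?_
    rw [hval (hvpos n), hveq, one_div, inv_inv, Real.sin_add_nat_mul_pi]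
    simp
  exact ⟨isConnected_graph hcont hu hupos hfu, not_compactSpace_graph hv hfv (by simp [h0]),
    polishSpace_graph hcont, isKingSpace_graph hcont hu hupos hfu⟩
end

section
/- Let I = [0,1], let π : I × I → I be the projection onto the first coordinate, and let f : I → I be a function such that: (a) the graph X^f = {(s, f(s)) : s ∈ I} is dense in I × I, and (b) X^f ∩ F ≠ ∅ for every closed subset F of I × I whose projection π(F) has cardinality 𝔠 (the cardinality of the continuum). Then X^f, with the subspace topology inherited from I × I, is connected. -/
open Set Filter Topology unitInterval

/-- The set of points whose whole vertical fibre lies in `U`. -/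
def fullFibers {X Y : Type*} (U : Set (X × Y)) : Set X := {s | ∀ y, (s, y) ∈ U}

theorem fullFibers_eq_compl_image {X Y : Type*} (U : Set (X × Y)) :
    fullFibers U = (Prod.fst '' Uᶜ)ᶜ := by
  ext s
  simp [fullFibers]

theorem IsOpen.fullFibers {X Y : Type*} [TopologicalSpace X] [TopologicalSpace Y]
    [CompactSpace Y] {U : Set (X × Y)} (hU : IsOpen U) : IsOpen (fullFibers U) := by
  rw [fullFibers_eq_compl_image]
  exact (isClosedMap_fst_of_compactSpace _ hU.isClosed_compl).isOpen_compl

theorem disjoint_fullFibers {X Y : Type*} [Nonempty Y] {U V : Set (X × Y)}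
    (hUV : Disjoint U V) : Disjoint (fullFibers U) (fullFibers V) :=
  Set.disjoint_left.2 fun _ hU hV =>
    Set.disjoint_left.1 hUV (hU (Classical.arbitrary Y)) (hV _)

theorem fullFibers_union {X Y : Type*} [TopologicalSpace X] [TopologicalSpace Y]
    [PreconnectedSpace Y] {U V : Set (X × Y)} (hU : IsOpen U) (hV : IsOpen V)
    (hUV : Disjoint U V) : fullFibers (U ∪ V) = fullFibers U ∪ fullFibers V := by
  ext s
  constructor
  · intro hs
    have hcont : Continuous fun y : Y => (s, y) := by fun_prop
    rcases isPreconnected_univ.subset_or_subset (hU.preimage hcont) (hV.preimage hcont)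
      (hUV.preimage _) (fun y _ => hs y) with h | h
    · exact Or.inl fun y => h (mem_univ y)
    · exact Or.inr fun y => h (mem_univ y)
  · rintro (h | h) y
    · exact Or.inl (h y)
    · exact Or.inr (h y)

/-- A connected set of full fibres of `U ∪ V` that accumulates at a point of `U` consists of
full fibres of `U`. -/
theorem subset_fullFibers_of_mem_closure {X Y : Type*} [TopologicalSpace X]
    [TopologicalSpace Y] [CompactSpace Y] {U V : Set (X × Y)} (hU : IsOpen U)
    (hV : IsOpen V) (hUV : Disjoint U V) {T : Set X} (hT : IsPreconnected T)
    (hTUV : T ⊆ fullFibers U ∪ fullFibers V) {s : X} {y : Y} (hsT : s ∈ closure T)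
    (hs : (s, y) ∈ U) : T ⊆ fullFibers U := by
  have : Nonempty Y := ⟨y⟩
  refine (hT.subset_or_subset hU.fullFibers hV.fullFibers (disjoint_fullFibers hUV)
    hTUV).resolve_right fun h => ?_
  have hcont : Continuous fun t : X => (t, y) := by fun_prop
  obtain ⟨t, htU, htT⟩ := mem_closure_iff.1 hsT _ (hU.preimage hcont) hs
  exact Set.disjoint_left.1 hUV htU (h htT y)

theorem mem_fullFibers_compl_closure {Y : Type*} [TopologicalSpace Y]
    [CompactSpace Y] {U V : Set (I × Y)} (hU : IsOpen U) (hV : IsOpen V)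
    (hUV : Disjoint U V) {s : I} {y : Y} (hs : (s, y) ∈ U)
    (hev : ∀ᶠ t in 𝓝[≠] s, t ∈ fullFibers U ∪ fullFibers V) :
    s ∈ fullFibers (closure V)ᶜ := by
  obtain ⟨b, c, hsbc, hnhds, hbc⟩ :=
    exists_Icc_mem_subset_of_mem_nhds (eventually_nhdsWithin_iff.1 hev)
  have hfull : ∀ t ∈ Icc b c, t ≠ s → t ∈ fullFibers U := by
    intro t ht hts
    rcases lt_or_gt_of_ne hts with h | h
    · refine subset_fullFibers_of_mem_closure hU hV hUV (T := Ico t s) isPreconnected_Ico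
        (fun r hr => hbc ⟨ht.1.trans hr.1, hr.2.le.trans hsbc.2⟩ hr.2.ne) ?_ hs
        (left_mem_Ico.2 h)
      rw [closure_Ico h.ne]
      exact right_mem_Icc.2 h.le
    · refine subset_fullFibers_of_mem_closure hU hV hUV (T := Ioc s t) isPreconnected_Ioc
        (fun r hr => hbc ⟨hsbc.1.trans hr.1.le, hr.2.trans ht.2⟩ hr.1.ne') ?_ hs
        (right_mem_Ioc.2 h)
      rw [closure_Ioc h.ne]
      exact left_mem_Icc.2 h.le
  intro z hz
  obtain ⟨⟨p, w⟩, hpV, hpJ⟩ := (mem_closure_iff_nhds.1 hz _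
    (continuous_fst.continuousAt.preimage_mem_nhds hnhds)).imp fun _ h => h.symm
  have hcont : Continuous fun t : I => (t, w) := by fun_prop
  by_cases hps : p = s
  · subst hps
    have hev' : ∀ᶠ t in 𝓝[≠] p, t ∈ Icc b c ∧ (t, w) ∈ V :=
      nhdsWithin_le_nhds (inter_mem hnhds ((hV.preimage hcont).mem_nhds hpV))
    obtain ⟨t, ⟨htJ, htV⟩, htp⟩ := (hev'.and self_mem_nhdsWithin).exists
    exact Set.disjoint_left.1 hUV (hfull t htJ htp w) htV
  · exact Set.disjoint_left.1 hUV (hfull p hpJ hps w) hpV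

theorem Perfect.continuum_le_mk {α : Type*} [MetricSpace α] [CompleteSpace α] {C : Set α}
    (hC : Perfect C) (hne : C.Nonempty) : Cardinal.continuum ≤ Cardinal.mk C := by
  obtain ⟨g, hg, -, hinj⟩ := hC.exists_nat_bool_injection hne
  have h := Cardinal.lift_mk_le_lift_mk_of_injective
    (f := fun x => (⟨g x, hg (mem_range_self x)⟩ : C))
    fun x y hxy => hinj (congrArg Subtype.val hxy)
  simpa using h

/-- Let `U` and `V` be disjoint open sets, each containing the exterior of the other. If `U ∪ V`
meets every vertical fibre, then its complement projects onto a perfect set. -/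
theorem perfect_image_fst_compl_union {Y : Type*} [TopologicalSpace Y] [CompactSpace Y]
    [PreconnectedSpace Y] {U V : Set (I × Y)} (hU : IsOpen U) (hV : IsOpen V)
    (hUV : Disjoint U V) (hUcl : (closure V)ᶜ ⊆ U) (hVcl : (closure U)ᶜ ⊆ V)
    (hmiss : ∀ s, ∃ y, (s, y) ∈ U ∪ V) : Perfect (Prod.fst '' (U ∪ V)ᶜ) := by
  refine ⟨isClosedMap_fst_of_compactSpace _ (hU.union hV).isClosed_compl, fun s hsK => ?_⟩
  rw [accPt_iff_frequently_nhdsNE]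
  intro hev
  have hev' : ∀ᶠ t in 𝓝[≠] s, t ∈ fullFibers U ∪ fullFibers V := by
    rw [← fullFibers_union hU hV hUV, fullFibers_eq_compl_image]
    exact hev
  obtain ⟨⟨t, z⟩, hz, rfl⟩ := hsK
  obtain ⟨y, hy | hy⟩ := hmiss t
  · exact hz (Or.inl (hUcl (mem_fullFibers_compl_closure hU hV hUV hy hev' z)))
  · rw [union_comm] at hev'
    exact hz (Or.inr (hVcl (mem_fullFibers_compl_closure hV hU hUV.symm hy hev' z)))

open unitInterval in
/-- If the graph of `f : I → I` is dense in `I × I` and meets every closed set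
whose first projection has cardinality continuum, then the graph is connected. -/
theorem dense_graph_connected (f : unitInterval → unitInterval)
    (Xf : Set (unitInterval × unitInterval))
    (hXf : Xf = {p : unitInterval × unitInterval | p.2 = f p.1})
    (hdense : Dense Xf)
    (hmeets : ∀ F : Set (unitInterval × unitInterval), IsClosed F →
      Cardinal.mk ↑(Prod.fst '' F) = Cardinal.continuum → (Xf ∩ F).Nonempty) :
    IsConnected Xf := by
  have hfib : ∀ s, (s, f s) ∈ Xf := fun s => by rw [hXf]; rfl
  refine ⟨⟨(0, f 0), hfib 0⟩, fun U₀ V₀ hU₀ hV₀ hsub hneU hneV => ?_⟩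
  by_contra hempty
  have hdisj₀ : Disjoint U₀ V₀ := by
    rw [Set.disjoint_iff_inter_eq_empty]
    by_contra hne
    refine hempty ?_
    rw [inter_comm]
    exact hdense.inter_open_nonempty _ (hU₀.inter hV₀) (nonempty_iff_ne_empty.2 hne)
  -- Replace the two sets by the complements of each other's closures.
  set U := (closure V₀)ᶜ
  set V := (closure U₀)ᶜ
  have hU : IsOpen U := isClosed_closure.isOpen_compl
  have hV : IsOpen V := isClosed_closure.isOpen_compl
  have hU₀U : U₀ ⊆ U := (hdisj₀.closure_right hU₀).subset_compl_right
  have hV₀V : V₀ ⊆ V := (hdisj₀.symm.closure_right hV₀).subset_compl_right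
  have hUV : Disjoint U V := by
    rw [Set.disjoint_left]
    intro p hpU hpV
    have hp : p ∈ closure (U₀ ∪ V₀) := closure_mono hsub (hdense p)
    rw [closure_union] at hp
    exact hp.elim hpV hpU
  have hXfUV : Xf ⊆ U ∪ V := hsub.trans (union_subset_union hU₀U hV₀V)
  have hperf : Perfect (Prod.fst '' (U ∪ V)ᶜ) :=
    perfect_image_fst_compl_union hU hV hUV
      (compl_subset_compl.2 (closure_mono hV₀V))
      (compl_subset_compl.2 (closure_mono hU₀U)) fun s => ⟨f s, hXfUV (hfib s)⟩
  rcases (Prod.fst '' (U ∪ V)ᶜ).eq_empty_or_nonempty with h | h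
  · have hcover : U ∪ V = univ := compl_empty_iff.1 (image_eq_empty.1 h)
    obtain ⟨p, -, hpU⟩ := hneU
    obtain ⟨q, -, hqV⟩ := hneV
    rcases isPreconnected_univ.subset_or_subset hU hV hUV hcover.ge with h' | h'
    · exact Set.disjoint_left.1 hUV (h' (mem_univ q)) (hV₀V hqV)
    · exact Set.disjoint_left.1 hUV (hU₀U hpU) (h' (mem_univ p))
  · have hcard : Cardinal.mk ↑(Prod.fst '' (U ∪ V)ᶜ) = Cardinal.continuum :=
      le_antisymm ((Cardinal.mk_set_le _).trans_eq (Cardinal.mk_Icc_real zero_lt_one))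
        (hperf.continuum_le_mk h)
    obtain ⟨p, hpX, hpF⟩ := hmeets _ (hU.union hV).isClosed_compl hcard
    exact hpF (hXfUV hpX)
end

section
/- Let I = [0,1] and let π : I × I → I be the projection onto the first coordinate. For every family 𝒢 of subsets of I × I of cardinality at most 𝔠 (the cardinality of the continuum), there exists a function f : I → I such that: (a) the graph X^f = {(s, f(s)) : s ∈ I} is dense in I × I; (b) X^f ∩ F ≠ ∅ for every closed subset F of I × I with |π(F)| = 𝔠; and (c) X^f ∉ 𝒢. -/
open Cardinal in
/-- A family of sets, each at least as large as the index type, has an injective choice function. -/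
theorem exists_injective_choice.{u, v} {ι : Type u} {α : Type v} (A : ι → Set α)
    (hA : ∀ i, Cardinal.lift.{v} #ι ≤ Cardinal.lift.{u} #(A i)) :
    ∃ s : ι → α, Function.Injective s ∧ ∀ i, s i ∈ A i := by
  obtain ⟨r, hr, hord⟩ := exists_ord_eq ι
  have step : ∀ (i : ι) (g : ∀ j, r j i → α),
      ∃ x ∈ A i, ∀ j (h : r j i), x ≠ g j h := by
    intro i g
    by_contra! hcon
    let R : Set α := Set.range fun j : {j // r j i} => g j.1 j.2
    have hsub : A i ⊆ R := by
      intro x hx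
      obtain ⟨j, hj, rfl⟩ := hcon x hx
      exact ⟨⟨j, hj⟩, rfl⟩
    have hlt : #{j // r j i} < #ι := by
      simpa using card_typein_lt i hord
    have h1 : Cardinal.lift.{u} #(A i) ≤ Cardinal.lift.{v} #{j // r j i} :=
      (Cardinal.lift_le.2 (mk_le_mk_of_subset hsub)).trans mk_range_le_lift
    exact absurd ((hA i).trans h1) (not_le.2 (Cardinal.lift_lt.2 hlt))
  choose next hmem hne using step
  let s : ι → α := hr.wf.fix next
  have hs : ∀ i, s i = next i fun j _ => s j := fun i => hr.wf.fix_eq next i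
  have hrel : ∀ i j, r j i → s i ≠ s j := by
    intro i j hji
    rw [hs i]
    exact hne i _ j hji
  refine ⟨s, fun i j hij => ?_, fun i => ?_⟩
  · rcases trichotomous_of r i j with h | h | h
    · exact absurd hij.symm (hrel j i h)
    · exact h
    · exact absurd hij (hrel i j h)
  · rw [hs i]
    exact hmem i _

open Cardinal in
/-- A second countable space has at most continuum many closed sets. -/
theorem mk_isClosed_le_continuum (X : Type*) [TopologicalSpace X] [SecondCountableTopology X] :
    #{F : Set X // IsClosed F} ≤ 𝔠 := by
  have hB := TopologicalSpace.isBasis_countableBasis X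
  let B := TopologicalSpace.countableBasis X
  have : Countable B := TopologicalSpace.countable_countableBasis X
  let e : {F : Set X // IsClosed F} → Set B := fun F => {u | (u : Set X) ⊆ (F : Set X)ᶜ}
  have he : Function.Injective e := by
    have key : ∀ F G : {F : Set X // IsClosed F}, e F = e G → (G : Set X) ⊆ F := by
      intro F G h x hx
      by_contra hxF
      obtain ⟨u, hu, hxu, huF⟩ := hB.exists_subset_of_mem_open hxF F.2.isOpen_compl
      have : (⟨u, hu⟩ : B) ∈ e G := h ▸ (show (⟨u, hu⟩ : B) ∈ e F from huF)
      exact this hxu hx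
    exact fun F G h => Subtype.ext ((key G F h.symm).antisymm (key F G h))
  calc #{F : Set X // IsClosed F} ≤ #(Set B) := mk_le_of_injective he
    _ = 2 ^ #B := mk_set
    _ ≤ 2 ^ ℵ₀ := power_le_power_left two_ne_zero (mk_le_aleph0_iff.2 this)
    _ = 𝔠 := two_power_aleph0

open Cardinal in
theorem unitInterval.mk_le_continuum (S : Set unitInterval) : #S ≤ 𝔠 := by
  refine (mk_set_le S).trans ?_
  rw [← mk_real]
  exact mk_subtype_le _

open Cardinal in
/-- Closed balls of positive radius in the unit interval have the cardinality of the continuum. -/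
theorem unitInterval.mk_closedBall (x : unitInterval) {r : ℝ} (hr : 0 < r) :
    #(Metric.closedBall x r) = 𝔠 := by
  refine le_antisymm (mk_le_continuum _) ?_
  have hlt : max 0 ((x : ℝ) - r) < min 1 ((x : ℝ) + r) := by
    have h0 := x.2.1
    have h1 := x.2.2
    refine max_lt (lt_min ?_ ?_) (lt_min ?_ ?_) <;> linarith
  rw [← mk_Icc_real hlt, ← mk_image_eq (s := Metric.closedBall x r) Subtype.val_injective]
  refine mk_le_mk_of_subset fun y hy => ?_
  obtain ⟨hy0, hy1⟩ := hy
  rw [max_le_iff] at hy0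
  rw [le_min_iff] at hy1
  refine ⟨⟨y, hy0.1, hy1.1⟩, ?_, rfl⟩
  rw [Metric.mem_closedBall, Subtype.dist_eq, Real.dist_eq, abs_le]
  constructor <;> linarith [hy0.2, hy1.2]

open unitInterval in
/-- For every family `𝒢` of at most continuum many subsets of `I × I` there is
`f : I → I` whose graph is dense, meets every closed set with projection of
size continuum, and does not belong to `𝒢`. -/
theorem exists_graph_avoiding (𝒢 : Set (Set (unitInterval × unitInterval)))
    (h𝒢 : Cardinal.mk ↥𝒢 ≤ Cardinal.continuum) :
    ∃ f : unitInterval → unitInterval,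
      Dense {p : unitInterval × unitInterval | p.2 = f p.1} ∧
      (∀ F : Set (unitInterval × unitInterval), IsClosed F →
        Cardinal.mk ↑(Prod.fst '' F) = Cardinal.continuum →
        ({p : unitInterval × unitInterval | p.2 = f p.1} ∩ F).Nonempty) ∧
      {p : unitInterval × unitInterval | p.2 = f p.1} ∉ 𝒢 := by
  classical
  let C := {F : {F : Set (I × I) // IsClosed F} //
    Cardinal.mk ↑(Prod.fst '' (F : Set (I × I))) = Cardinal.continuum}
  let A : C ⊕ 𝒢 → Set I := Sum.elim (fun F => Prod.fst '' (F.1 : Set (I × I))) fun _ => Set.univ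
  have hindex : Cardinal.mk (C ⊕ 𝒢) ≤ Cardinal.continuum := by
    rw [Cardinal.mk_sum, Cardinal.lift_id, Cardinal.lift_id]
    exact Cardinal.add_le_of_le Cardinal.aleph0_le_continuum
      ((Cardinal.mk_subtype_le _).trans (mk_isClosed_le_continuum _)) h𝒢
  have hA : ∀ j, Cardinal.continuum ≤ Cardinal.mk (A j) := by
    rintro (F | G)
    · exact F.2.ge
    · exact (unitInterval.mk_closedBall 0 one_pos).ge.trans
        (Cardinal.mk_le_mk_of_subset (Set.subset_univ _))
  obtain ⟨s, hs, hsA⟩ := exists_injective_choice A fun j => by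
    simpa only [Cardinal.lift_id] using hindex.trans (hA j)
  have hval : ∀ F : C, ∃ y, (s (Sum.inl F), y) ∈ (F.1 : Set (I × I)) := by
    intro F
    obtain ⟨⟨x, y⟩, hp, hx⟩ := hsA (Sum.inl F)
    exact ⟨y, hx ▸ hp⟩
  choose v hv using hval
  let w : C ⊕ 𝒢 → I := Sum.elim v fun G => if (s (Sum.inr G), 0) ∈ (G : Set (I × I)) then 1 else 0
  let f : I → I := Function.extend s w 0
  have hf : ∀ j, f (s j) = w j := fun j => hs.extend_apply w 0 j
  have hclosed : ∀ F : Set (I × I), IsClosed F →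
      Cardinal.mk ↑(Prod.fst '' F) = Cardinal.continuum →
      ({p : I × I | p.2 = f p.1} ∩ F).Nonempty := fun F hF hc =>
    ⟨(s (Sum.inl ⟨⟨F, hF⟩, hc⟩), v ⟨⟨F, hF⟩, hc⟩), (hf (Sum.inl ⟨⟨F, hF⟩, hc⟩)).symm,
      hv ⟨⟨F, hF⟩, hc⟩⟩
  refine ⟨f, ?_, hclosed, fun hG => ?_⟩
  · rw [Metric.dense_iff]
    intro p r hr
    have hhalf : 0 < r / 2 := half_pos hr
    obtain ⟨q, hq, hqp⟩ := hclosed (Metric.closedBall p (r / 2)) Metric.isClosed_closedBall <| by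
      rw [← closedBall_prod_same, Set.fst_image_prod _ ⟨p.2, Metric.mem_closedBall_self hhalf.le⟩]
      exact unitInterval.mk_closedBall p.1 hhalf
    exact ⟨q, Metric.closedBall_subset_ball (half_lt_self hr) hqp, hq⟩
  · have h := hf (Sum.inr ⟨_, hG⟩)
    by_cases h0 : (s (Sum.inr ⟨_, hG⟩), (0 : I)) ∈ {p : I × I | p.2 = f p.1}
    · have hw : w (Sum.inr ⟨_, hG⟩) = 1 := if_pos h0
      exact zero_ne_one ((show (0 : I) = _ from h0).trans (h.trans hw))
    · have hw : w (Sum.inr ⟨_, hG⟩) = 0 := if_neg h0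
      exact h0 (h.trans hw).symm
end
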